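/- arXiv:1506.00864 — 3 statements merged into one kernel-verified Lean document; each statement's English description precedes it below -/
import Mathlib

section
/- Let F be an intersecting butterfly-free family of subsets of [n] such that 2 ≤ |F| ≤ n−2 for all F ∈ F. Then Σ_{F ∈ F, |F| ≤ n/2} 1/C(n, |F|−1) + Σ_{F ∈ F, |F| > n/2} 1/C(n, |F|) ≤ 2. -/
/-- `Σ_I(n,k)` from the paper. -/
def SigmaI (n k : ℕ) : ℕ :=
  if n % 2 = 1 then
    ∑ i ∈ Finset.Icc ((n + 1) / 2) ((n + 1) / 2 + k - 1), Nat.choose n i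
  else
    Nat.choose (n - 1) (n / 2 - 1) +
      ∑ i ∈ Finset.Icc (n / 2 + 1) (n / 2 + k - 1), Nat.choose n i +
      Nat.choose (n - 1) (n / 2 + k)

/-- A family of finite sets is intersecting if any two members meet. -/
def Intersecting {α : Type*} [DecidableEq α] (F : Finset (Finset α)) : Prop :=
  ∀ A ∈ F, ∀ B ∈ F, (A ∩ B).Nonempty

/-- A family is butterfly-free if there are no four distinct members
`A,B,C,D` with `A ⊆ C`, `A ⊆ D`, `B ⊆ C`, `B ⊆ D`. -/
def ButterflyFree {α : Type*} (F : Finset (Finset α)) : Prop :=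
  ¬ ∃ A B C D : Finset α, A ∈ F ∧ B ∈ F ∧ C ∈ F ∧ D ∈ F ∧
    A ≠ B ∧ A ≠ C ∧ A ≠ D ∧ B ≠ C ∧ B ≠ D ∧ C ≠ D ∧
    A ⊆ C ∧ A ⊆ D ∧ B ⊆ C ∧ B ⊆ D

/-- A family is `k`-Sperner if it contains no chain of `k+1` distinct sets. -/
def KSperner {α : Type*} (k : ℕ) (F : Finset (Finset α)) : Prop :=
  ¬ ∃ c : Fin (k + 1) → Finset α, (∀ i, c i ∈ F) ∧ StrictMono c

namespace CircularArc

open Finset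

section Arcs

/-- The number of clockwise steps from `i` to `j` on the circle `Fin n`. -/
def gap {n : ℕ} (i j : Fin n) : ℕ :=
  if i.val ≤ j.val then j.val - i.val else n + j.val - i.val

/-- The arc of `s` consecutive points starting at `i`. -/
def arc {n : ℕ} (i : Fin n) (s : ℕ) : Finset (Fin n) := {x | gap i x < s}

variable {n : ℕ}

lemma gap_lt (i j : Fin n) : gap i j < n := by
  unfold gap; split_ifs <;> omega

@[simp] lemma gap_self (i : Fin n) : gap i i = 0 := by simp [gap]

lemma gap_injective (i : Fin n) : Function.Injective (gap i) := by
  intro j k h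
  unfold gap at h
  apply Fin.ext
  split_ifs at h <;> omega

lemma gap_eq_zero {i j : Fin n} (h : gap i j = 0) : i = j :=
  gap_injective i (by simp [h])

lemma gap_add (i j k : Fin n) :
    gap i j + gap j k = gap i k ∨ gap i j + gap j k = gap i k + n := by
  unfold gap; split_ifs <;> omega

lemma exists_gap_eq (i : Fin n) {t : ℕ} (ht : t < n) : ∃ j : Fin n, gap i j = t := by
  by_cases h : i.val + t < n
  · exact ⟨⟨i + t, h⟩, by simp [gap]⟩
  · refine ⟨⟨i + t - n, by omega⟩, ?_⟩
    unfold gap; simp only; split_ifs <;> omega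

lemma mem_arc {i x : Fin n} {s : ℕ} : x ∈ arc i s ↔ gap i x < s := by simp [arc]

lemma card_arc (i : Fin n) {s : ℕ} (hs : s ≤ n) : #(arc i s) = s := by
  have : (arc i s).image (gap i) = range s := by
    ext t
    simp only [mem_image, mem_arc, mem_range]
    constructor
    · rintro ⟨x, hx, rfl⟩; exact hx
    · intro ht
      obtain ⟨j, hj⟩ := exists_gap_eq i (ht.trans_le hs)
      exact ⟨j, hj ▸ ht, hj⟩
  rw [← card_image_of_injective _ (gap_injective i), this, card_range]

lemma arc_subset_arc {i j : Fin n} {s t : ℕ} (h : gap i j + t ≤ s) : arc j t ⊆ arc i s := by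
  intro x hx
  rw [mem_arc] at *
  have := gap_add i j x
  omega

lemma disjoint_arc {i j : Fin n} {s t : ℕ} (h₁ : s ≤ gap i j) (h₂ : gap i j + t ≤ n) :
    Disjoint (arc i s) (arc j t) := by
  rw [Finset.disjoint_left]
  intro x hx hx'
  rw [mem_arc] at *
  have := gap_add i j x
  omega

lemma arc_left_injective {i j : Fin n} {s : ℕ} (hs : 0 < s) (hsn : s < n)
    (h : arc i s = arc j s) : i = j := by
  by_contra hij
  obtain ⟨x, hx⟩ := exists_gap_eq i (show n - 1 < n by omega)
  have hxi : x ∉ arc i s := by rw [mem_arc]; omega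
  have hi : i ∈ arc j s := h ▸ mem_arc.2 (by simpa using hs)
  have h0 : gap j i ≠ 0 := fun h0 => hij (gap_eq_zero h0).symm
  rw [h, mem_arc] at hxi
  rw [mem_arc] at hi
  have := gap_add j i x
  have := gap_lt j x
  omega

/-- No arc of the family, given by starting point and length, is nested in another one. -/
def Sperner (G : Finset (Fin n × ℕ)) : Prop :=
  ∀ p ∈ G, ∀ q ∈ G, p ≠ q → p.2 < gap p.1 q.1 + q.2

/-- Any two arcs of the family, given by starting point and length, meet. -/
def Meeting (G : Finset (Fin n × ℕ)) : Prop :=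
  ∀ p ∈ G, ∀ q ∈ G, p.2 ≤ gap p.1 q.1 → n < gap p.1 q.1 + q.2

variable {G : Finset (Fin n × ℕ)}

lemma Meeting.mono {H : Finset (Fin n × ℕ)} (hG : Meeting G) (h : H ⊆ G) : Meeting H :=
  fun p hp q hq => hG p (h hp) q (h hq)

lemma Sperner.fst_injOn (hG : Sperner G) : Set.InjOn Prod.fst (G : Set (Fin n × ℕ)) := by
  intro p hp q hq h
  by_contra hpq
  have h₁ := hG p hp q hq hpq
  have h₂ := hG q hq p hp (Ne.symm hpq)
  rw [h, gap_self] at h₁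
  rw [h, gap_self] at h₂
  omega

lemma Sperner.eq_of_gap_add_eq (hG : Sperner G) (i : Fin n) {p q : Fin n × ℕ} (hp : p ∈ G)
    (hq : q ∈ G) (h : gap i p.1 + p.2 = gap i q.1 + q.2) : p = q := by
  by_contra hpq
  have h₁ := hG p hp q hq hpq
  have h₂ := hG q hq p hp (Ne.symm hpq)
  have := gap_add i p.1 q.1
  have := gap_add i q.1 p.1
  have := gap_lt i p.1
  have := gap_lt i q.1
  have := gap_lt p.1 q.1
  have := gap_lt q.1 p.1
  omega

lemma Sperner.card_add_le (hG : Sperner G) {p q : Fin n × ℕ} (hp : p ∈ G) (hq : q ∈ G)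
    (hpq : q.2 < p.2) (hpn : p.2 ≤ n) : #G + p.2 ≤ n + q.2 := by
  have hne : p ≠ q := by rintro rfl; exact lt_irrefl _ hpq
  have hlt := hG p hp q hq hne
  have hP := gap_lt p.1 q.1
  have start : ∀ r ∈ G, r = p ∨ p.2 < gap p.1 r.1 + r.2 := fun r hr =>
    (eq_or_ne r p).imp_right fun h => hG p hp r hr h.symm
  have ends_le : ∀ r ∈ G, gap p.1 r.1 ≤ gap p.1 q.1 →
      gap p.1 r.1 + r.2 ≤ gap p.1 q.1 + q.2 := by
    intro r hr hle
    rcases eq_or_ne r q with rfl | h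
    · exact le_rfl
    · have h1 := hG r hr q hq h
      have := gap_add p.1 r.1 q.1
      have := gap_lt r.1 q.1
      omega
  have key : #G ≤ #(range (n + q.2 - p.2)) := by
    apply card_le_card_of_injOn (fun r => if gap p.1 r.1 ≤ gap p.1 q.1 then
      gap p.1 r.1 + r.2 - p.2 else gap p.1 r.1 + q.2 - p.2)
    · intro r hr
      have hr1 := start r hr
      have hr2 := ends_le r hr
      have hr3 := gap_lt p.1 r.1
      have hr4 : r = p → gap p.1 r.1 + r.2 = p.2 := by rintro rfl; simp
      simp only [coe_range, Set.mem_Iio]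
      split_ifs with hc
      · have := hr2 hc
        omega
      · omega
    · intro r hr r' hr' h
      have s1 : p.2 ≤ gap p.1 r.1 + r.2 := by
        rcases start r hr with rfl | h
        · omega
        · omega
      have s2 : p.2 ≤ gap p.1 r'.1 + r'.2 := by
        rcases start r' hr' with rfl | h
        · omega
        · omega
      have t1 := ends_le r hr
      have t2 := ends_le r' hr'
      simp only at h
      split_ifs at h with c1 c2 c2
      · exact hG.eq_of_gap_add_eq p.1 hr hr' (by omega)
      · have := t1 c1; omega
      · have := t2 c2; omega
      · exact hG.fst_injOn hr hr' (gap_injective p.1 (by omega))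
  rw [card_range] at key
  omega

lemma Sperner.card_le (hG : Sperner G) : #G ≤ n := by
  simpa using card_le_card_of_injOn Prod.fst (fun _ _ => mem_coe.2 (mem_univ _)) hG.fst_injOn

/-- An arc meeting and incomparable to the arc `a` has an end strictly inside `a`. -/
lemma end_mem (hG : Sperner G) (hM : Meeting G) {a q : Fin n × ℕ} (ha : a ∈ G)
    (hq : q ∈ G) (ha0 : 0 < a.2) : gap a.1 q.1 < a.2 ∨
      (n < gap a.1 q.1 + q.2 ∧ gap a.1 q.1 + q.2 < n + a.2) := by
  rcases lt_or_ge (gap a.1 q.1) a.2 with h | h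
  · exact Or.inl h
  · refine Or.inr ⟨hM a ha q hq h, ?_⟩
    have hne : q ≠ a := by
      rintro rfl
      simp at h; omega
    have h1 := hG q hq a ha hne
    have hadd := gap_add a.1 q.1 a.1
    have := gap_lt a.1 q.1
    rw [gap_self] at hadd
    omega

lemma card_le_two_mul_sub_one (hG : Sperner G) (hM : Meeting G) {a : Fin n × ℕ}
    (ha : a ∈ G) (ha0 : 0 < a.2) : #G ≤ 2 * a.2 - 1 := by
  have key : #G ≤ #(range (2 * a.2 - 1)) := by
    apply card_le_card_of_injOn (fun q => if gap a.1 q.1 < a.2 then gap a.1 q.1 else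
      a.2 - 1 + (gap a.1 q.1 + q.2 - n))
    · intro q hq
      have := end_mem hG hM ha hq ha0
      simp only [coe_range, Set.mem_Iio]
      split_ifs <;> omega
    · intro q hq r hr h
      have h1 := end_mem hG hM ha hq ha0
      have h2 := end_mem hG hM ha hr ha0
      simp only at h
      split_ifs at h
      · exact hG.fst_injOn hq hr (gap_injective a.1 h)
      · omega
      · omega
      · exact hG.eq_of_gap_add_eq a.1 hq hr (by omega)
  rwa [card_range] at key

/-- The point of the arc `a` at which an arc crossing `a` starts, or before which it ends. -/
def slot (a q : Fin n × ℕ) : ℕ :=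
  if gap a.1 q.1 < a.2 then gap a.1 q.1 else gap a.1 q.1 + q.2 - n

lemma slot_lt (hG : Sperner G) (hM : Meeting G) {a q : Fin n × ℕ} (ha : a ∈ G)
    (hq : q ∈ G) (ha0 : 0 < a.2) : slot a q < a.2 := by
  have := end_mem hG hM ha hq ha0
  unfold slot
  split_ifs <;> omega

lemma eq_of_slot_eq (hG : Sperner G) (hM : Meeting G) {a q r : Fin n × ℕ} (ha : a ∈ G)
    (hq : q ∈ G) (hr : r ∈ G) (ha0 : 0 < a.2) (h : slot a q = slot a r)
    (hside : gap a.1 q.1 < a.2 ↔ gap a.1 r.1 < a.2) : q = r := by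
  have h1 := end_mem hG hM ha hq ha0
  have h2 := end_mem hG hM ha hr ha0
  unfold slot at h
  split_ifs at h
  · exact hG.fst_injOn hq hr (gap_injective a.1 h)
  · omega
  · omega
  · exact hG.eq_of_gap_add_eq a.1 hq hr (by omega)

lemma eq_of_slot_eq_of_add_le (hG : Sperner G) (hM : Meeting G) {a q r : Fin n × ℕ}
    (ha : a ∈ G) (hq : q ∈ G) (hr : r ∈ G) (ha0 : 0 < a.2) (h : slot a q = slot a r)
    (hqr : q.2 + r.2 ≤ n) : q = r := by
  have main : ∀ {q r : Fin n × ℕ}, q ∈ G → r ∈ G → slot a q = slot a r → q.2 + r.2 ≤ n →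
      gap a.1 q.1 < a.2 → gap a.1 r.1 < a.2 := by
    intro q r hq hr h hqr hc
    by_contra hc'
    have h2 := end_mem hG hM ha hr ha0
    unfold slot at h
    rw [if_pos hc, if_neg hc'] at h
    have h3 := hM r hr q hq
    have := gap_add a.1 r.1 q.1
    have := gap_lt a.1 r.1
    have := gap_lt r.1 q.1
    omega
  exact eq_of_slot_eq hG hM ha hq hr ha0 h
    ⟨main hq hr h hqr, main hr hq h.symm (by omega)⟩

lemma card_small_le (hG : Sperner G) (hM : Meeting G) {a : Fin n × ℕ} (ha : a ∈ G)
    (ha0 : 0 < a.2) : #{q ∈ G | 2 * q.2 ≤ n} ≤ a.2 := by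
  have key : #{q ∈ G | 2 * q.2 ≤ n} ≤ #(range a.2) := by
    apply card_le_card_of_injOn (slot a)
    · intro q hq
      simpa using slot_lt hG hM ha (mem_filter.1 hq).1 ha0
    · intro q hq r hr h
      have hq := mem_filter.1 hq
      have hr := mem_filter.1 hr
      exact eq_of_slot_eq_of_add_le hG hM ha hq.1 hr.1 ha0 h (by omega)
  rwa [card_range] at key

/-- The weight of an arc of length `s` on a circle of `n` points. -/
def weight (n s : ℕ) : ℚ := if 2 * s ≤ n then (n + 1) / s - 1 else 1

lemma sum_weight_le {k : ℕ} (hk : 0 < k) (h : ∀ q ∈ G, 2 * q.2 ≤ n → k ≤ q.2) :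
    ∑ q ∈ G, weight n q.2 ≤ #G + #{q ∈ G | 2 * q.2 ≤ n} * ((n + 1) / k - 2 : ℚ) := by
  have e : ∀ q ∈ G, weight n q.2 ≤ 1 + if 2 * q.2 ≤ n then ((n + 1) / k - 2 : ℚ) else 0 := by
    intro q hq
    unfold weight
    split_ifs with hs
    · have hkq : (k : ℚ) ≤ q.2 := by exact_mod_cast h q hq hs
      have hk' : (0 : ℚ) < k := by exact_mod_cast hk
      have : ((n : ℚ) + 1) / q.2 ≤ (n + 1) / k := by gcongr
      linarith
    · simp
  refine (sum_le_sum e).trans_eq ?_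
  rw [sum_add_distrib, ← sum_filter]
  simp only [sum_const, nsmul_eq_mul, mul_one]

/-- The weights of a meeting Sperner family of arcs add up to at most `n`. -/
lemma sum_weight_le_card (hG : Sperner G) (hM : Meeting G) (h0 : ∀ q ∈ G, 0 < q.2) :
    ∑ q ∈ G, weight n q.2 ≤ n := by
  rcases (G.filter fun q => 2 * q.2 ≤ n).eq_empty_or_nonempty with hS | hS
  · refine (sum_weight_le one_pos fun q hq _ => h0 q hq).trans ?_
    rw [hS]
    simpa using hG.card_le
  · obtain ⟨a, ha, hmin⟩ := exists_min_image _ (fun q : Fin n × ℕ => q.2) hS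
    obtain ⟨haG, han⟩ := mem_filter.1 ha
    have ha0 := h0 a haG
    refine (sum_weight_le ha0 fun q hq hqn => hmin q (mem_filter.2 ⟨hq, hqn⟩)).trans ?_
    have c1 : (#G : ℚ) ≤ 2 * a.2 - 1 := by
      have := card_le_two_mul_sub_one hG hM haG ha0
      have : #G + 1 ≤ 2 * a.2 := by omega
      have : (#G : ℚ) + 1 ≤ 2 * a.2 := by exact_mod_cast this
      linarith
    have c2 : (#{q ∈ G | 2 * q.2 ≤ n} : ℚ) ≤ a.2 := by
      exact_mod_cast card_small_le hG hM haG ha0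
    have ha' : (0 : ℚ) < a.2 := by exact_mod_cast ha0
    have han' : 2 * (a.2 : ℚ) ≤ n := by exact_mod_cast han
    have nn : (0 : ℚ) ≤ (n + 1) / a.2 - 2 := by
      rw [sub_nonneg, le_div_iff₀ ha']; linarith
    calc _ ≤ (2 * a.2 - 1 : ℚ) + a.2 * ((n + 1) / a.2 - 2) := by gcongr
      _ = n := by field_simp; ring

/-- A family of arcs containing one of length two loses at least one. -/
lemma sum_weight_le_of_two_mem (hG : Sperner G) (hM : Meeting G) (hn : 6 ≤ n)
    (hsize : ∀ q ∈ G, 2 ≤ q.2 ∧ q.2 ≤ n - 2) {i : Fin n} (hi : (i, 2) ∈ G) :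
    ∑ q ∈ G, weight n q.2 ≤ n - 1 := by
  have hn' : (6 : ℚ) ≤ n := by exact_mod_cast hn
  have hGc : #G ≤ 3 := card_le_two_mul_sub_one hG hM hi (by norm_num)
  have hSc : #{q ∈ G | 2 * q.2 ≤ n} ≤ 2 := card_small_le hG hM hi (by norm_num)
  have base := sum_weight_le (G := G) two_pos fun q hq _ => (hsize q hq).1
  by_cases hS : #{q ∈ G | 2 * q.2 ≤ n} ≤ 1
  · have c1 : (#G : ℚ) ≤ 3 := by exact_mod_cast hGc
    have c2 : (#{q ∈ G | 2 * q.2 ≤ n} : ℚ) ≤ 1 := by exact_mod_cast hS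
    push_cast at base
    nlinarith
  by_cases h2 : ∃ j, j ≠ i ∧ (j, 2) ∈ G
  · have hG2 : #G ≤ 2 := by
      have main : ∀ i j : Fin n, (i, 2) ∈ G → (j, 2) ∈ G → gap i j = 1 →
          G ⊆ {(i, 2), (j, 2)} := by
        intro i j hi hj hij q hq
        by_contra hne
        simp only [mem_insert, mem_singleton, not_or] at hne
        have a1 := hG _ hi q hq (Ne.symm hne.1)
        have a2 := hG _ hj q hq (Ne.symm hne.2)
        have a3 := hG q hq _ hi hne.1
        have a4 := hG q hq _ hj hne.2
        have b1 := hM _ hi q hq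
        have b2 := hM _ hj q hq
        have := hsize q hq
        have := gap_add i j q.1
        have := gap_add i q.1 i
        have := gap_add j q.1 j
        have := gap_lt i q.1
        have := gap_lt j q.1
        have := gap_lt q.1 i
        have := gap_lt q.1 j
        simp only [gap_self] at *
        omega
      obtain ⟨j, hji, hj⟩ := h2
      have h0 : gap i j ≠ 0 := fun h => hji (gap_eq_zero h).symm
      have b1 := hM _ hi _ hj
      have b2 := hM _ hj _ hi
      have b3 := gap_add i j i
      have := gap_lt i j
      have := gap_lt j i
      simp only [gap_self] at b1 b2 b3
      rcases (by omega : gap i j = 1 ∨ gap j i = 1) with h | h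
      · exact (card_le_card (main i j hi hj h)).trans card_le_two
      · exact (card_le_card (main j i hj hi h)).trans card_le_two
    have c1 : (#G : ℚ) ≤ 2 := by exact_mod_cast hG2
    have c2 : (#{q ∈ G | 2 * q.2 ≤ n} : ℚ) ≤ 2 := by exact_mod_cast hSc
    push_cast at base
    nlinarith
  · have hE := sum_weight_le (G := G.erase (i, 2)) (n := n) (k := 3) (by norm_num) (by
      intro q hq _
      obtain ⟨hne, hq⟩ := mem_erase.1 hq
      have := (hsize q hq).1
      by_contra hlt
      refine h2 ⟨q.1, fun h => hne (Prod.ext h (by simp only; omega)), ?_⟩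
      rwa [show (2 : ℕ) = q.2 by omega])
    rw [← add_sum_erase _ _ hi]
    have c1 : (#(G.erase (i, 2)) : ℚ) ≤ 2 := by
      rw [card_erase_of_mem hi]; exact_mod_cast (by omega : #G - 1 ≤ 2)
    have c2 : (#{q ∈ G.erase (i, 2) | 2 * q.2 ≤ n} : ℚ) ≤ 1 := by
      rw [filter_erase, card_erase_of_mem (mem_filter.2 ⟨hi, by simp only; omega⟩)]
      exact_mod_cast (by omega : #{q ∈ G | 2 * q.2 ≤ n} - 1 ≤ 1)
    have w2 : weight n 2 = (n + 1) / 2 - 1 := by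
      unfold weight; rw [if_pos (by omega)]; norm_num
    push_cast at hE
    rw [w2]
    nlinarith

lemma sum_weight_add_half_card_le (hG : Sperner G) (hM : Meeting G) (hn : 6 ≤ n)
    (hsize : ∀ q ∈ G, 2 ≤ q.2 ∧ q.2 ≤ n - 2) {Q : Finset (Fin n)}
    (hQ : ∀ j ∈ Q, ∃ i, (i, 2) ∈ G ∧ gap j i ≤ 1 ∧
      ∀ i', (i', 2) ∈ G → gap j i' ≤ 1 → i' = i) :
    ∑ q ∈ G, weight n q.2 + #Q / 2 ≤ n := by
  rcases Q.eq_empty_or_nonempty with rfl | ⟨j₀, hj₀⟩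
  · simpa using sum_weight_le_card hG hM fun q hq => by have := (hsize q hq).1; omega
  obtain ⟨i₀, hi₀, -, -⟩ := hQ j₀ hj₀
  have adj : ∀ {i j : Fin n}, (i, 2) ∈ G → (j, 2) ∈ G → i = j ∨ gap i j = 1 ∨ gap j i = 1 := by
    intro i j hi hj
    have b1 := hM _ hi _ hj
    have b2 := hM _ hj _ hi
    have b3 := gap_add i j i
    have := gap_lt i j
    have := gap_lt j i
    have := @gap_eq_zero _ i j
    simp only [gap_self] at b1 b2 b3
    omega
  have two : ∀ i k : Fin n, (i, 2) ∈ G → (k, 2) ∈ G → gap i k = 1 → #Q ≤ 2 := by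
    intro i k hi hk hik
    obtain ⟨l, hl⟩ := exists_gap_eq i (show n - 1 < n by omega)
    refine (card_le_card (t := {k, l}) fun j hj => ?_).trans card_le_two
    obtain ⟨m, hm, hjm, huniq⟩ := hQ j hj
    rw [mem_insert, mem_singleton]
    have hne : gap i j ≠ 0 := by
      intro h
      obtain rfl := gap_eq_zero h
      have e1 := huniq i hi (by simp)
      have e2 := huniq k hk hik.le
      rw [e1, ← e2, gap_self] at hik
      omega
    have hm' : m = i ∨ m = k := by
      rcases adj hi hm with h | h | h
      · exact Or.inl h.symm
      · exact Or.inr (gap_injective i (h.trans hik.symm))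
      · have c := gap_add m i k
        have := gap_lt m k
        rcases adj hk hm with h' | h' | h'
        · exact Or.inr h'.symm
        · have c' := gap_add m k m
          rw [gap_self] at c'
          omega
        · omega
    rcases hm' with rfl | rfl
    · right
      apply gap_injective m
      have c := gap_add m j m
      rw [gap_self] at c
      have := gap_lt m j
      omega
    · left
      apply gap_injective i
      have c := gap_add i j m
      have := gap_lt i j
      omega
  have hQ2 : #Q ≤ 2 := by
    by_cases h : ∃ k, k ≠ i₀ ∧ (k, 2) ∈ G
    · obtain ⟨k, hk, hkG⟩ := h
      rcases adj hi₀ hkG with h | h | h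
      · exact absurd h.symm hk
      · exact two _ _ hi₀ hkG h
      · exact two _ _ hkG hi₀ h
    · obtain ⟨l, hl⟩ := exists_gap_eq i₀ (show n - 1 < n by omega)
      refine (card_le_card (t := {i₀, l}) fun j hj => ?_).trans card_le_two
      obtain ⟨m, hm, hjm, -⟩ := hQ j hj
      obtain rfl : m = i₀ := by by_contra hne; exact h ⟨m, hne, hm⟩
      rw [mem_insert, mem_singleton]
      rcases (by omega : gap j m = 0 ∨ gap j m = 1) with h0 | h1
      · exact Or.inl (gap_eq_zero h0)
      · right
        apply gap_injective m
        have c := gap_add m j m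
        rw [gap_self] at c
        have := gap_lt m j
        omega
  have hQ2' : (#Q : ℚ) ≤ 2 := by exact_mod_cast hQ2
  have := sum_weight_le_of_two_mem hG hM hn hsize hi₀
  linarith

lemma Sperner.eq_of_end_eq (hG : Sperner G) (h0 : ∀ q ∈ G, 0 < q.2) {p q : Fin n × ℕ}
    (hp : p ∈ G) (hq : q ∈ G) {x : Fin n} (hpx : gap p.1 x = p.2 - 1)
    (hqx : gap q.1 x = q.2 - 1) : p = q := by
  by_contra hpq
  have h₁ := hG p hp q hq hpq
  have h₂ := hG q hq p hp (Ne.symm hpq)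
  have := h0 p hp
  have := h0 q hq
  have := gap_add p.1 q.1 x
  have := gap_add q.1 p.1 x
  have := gap_lt p.1 x
  have := gap_lt q.1 x
  have := gap_lt p.1 q.1
  have := gap_lt q.1 p.1
  omega

/-- Arcs of length `n - 3`, indexed by their starting points, each of which is contained in a
unique arc of `G`, of length `n - 2`, and contains no arc of `G`. -/
structure Covered (G : Finset (Fin n × ℕ)) (R : Finset (Fin n)) : Prop where
  up : ∀ j ∈ R, ∃ i, (i, n - 2) ∈ G ∧ gap i j ≤ 1 ∧
    ∀ i', (i', n - 2) ∈ G → gap i' j ≤ 1 → i' = i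
  down : ∀ j ∈ R, ∀ p ∈ G, n - 3 < gap j p.1 + p.2
  meeting : Meeting (R.image (fun j => (j, n - 3)) ∪ G)

variable {R : Finset (Fin n)}

lemma Covered.card_add_half_card_le (hR : Covered G R) (hG : Sperner G) (hn : 6 ≤ n)
    (hsize : ∀ q ∈ G, 2 ≤ q.2 ∧ q.2 ≤ n - 2) : (#G + #R / 2 : ℚ) ≤ n := by
  classical
  set R₂ := R.filter fun j => (j, n - 2) ∈ G
  set R₁ := R.filter fun j => (j, n - 2) ∉ G
  have hcard : #R₂ + #R₁ = #R := card_filter_add_card_filter_not _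
  have h1 : #G + #R₁ ≤ n := by
    rw [← card_image_of_injOn hG.fst_injOn, ← card_union_of_disjoint]
    · simpa using card_le_univ (G.image Prod.fst ∪ R₁)
    · rw [disjoint_left]
      intro j hj hj1
      obtain ⟨q, hq, rfl⟩ := mem_image.1 hj
      obtain ⟨hjR, hj1⟩ := mem_filter.1 hj1
      have hd := hR.down _ hjR q hq
      have := hsize q hq
      rw [gap_self] at hd
      exact hj1 (by rwa [show n - 2 = q.2 by omega])
  have h2 : #G + #R₂ ≤ n := by
    have ex : ∀ q : Fin n × ℕ, ∃ x, gap q.1 x = (q.2 - 1) % n := fun q =>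
      exists_gap_eq _ (Nat.mod_lt _ (by omega))
    choose last hlast using ex
    have hl : ∀ q ∈ G, gap q.1 (last q) = q.2 - 1 := fun q hq => by
      have := hsize q hq
      rw [hlast, Nat.mod_eq_of_lt (by omega)]
    have hl' : ∀ j, gap j (last (j, n - 3)) = n - 3 - 1 := fun j => by
      rw [hlast (j, n - 3), Nat.mod_eq_of_lt (by simp only; omega)]
    have i1 : Set.InjOn last G := fun p hp q hq h =>
      hG.eq_of_end_eq (fun q hq => by have := hsize q hq; omega) hp hq (hl p hp) (h ▸ hl q hq)
    have i2 : Set.InjOn (fun j => last (j, n - 3)) (R₂ : Set (Fin n)) := by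
      intro j _ k _ h
      have a := hl' j
      have b := hl' k
      simp only at h
      rw [h] at a
      have := gap_add j k (last (k, n - 3))
      have := gap_lt j k
      exact gap_eq_zero (by omega)
    rw [← card_image_of_injOn i1, ← card_image_of_injOn i2, ← card_union_of_disjoint]
    · simpa using card_le_univ (G.image last ∪ R₂.image fun j => last (j, n - 3))
    · rw [disjoint_left]
      intro x hx hx'
      obtain ⟨q, hq, rfl⟩ := mem_image.1 hx
      obtain ⟨j, hj, hjq⟩ := mem_image.1 hx'
      obtain ⟨hjR, hj2⟩ := mem_filter.1 hj
      have a := hl q hq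
      have b := hl' j
      rw [hjq] at b
      have c := hR.down _ hjR q hq
      have d := hsize q hq
      have e1 := gap_add j q.1 (last q)
      have e2 := gap_add q.1 j (last q)
      have := gap_lt j q.1
      have := gap_lt q.1 j
      have := gap_lt q.1 (last q)
      have := gap_lt j (last q)
      have hq2 : q.2 = n - 2 := by omega
      obtain ⟨i, -, -, hu⟩ := hR.up j hjR
      have u1 := hu j hj2 (by simp)
      have u2 := hu q.1 (by rwa [← hq2]) (by omega)
      have : gap j q.1 = 0 := by rw [u1, u2]; simp
      omega
  have h1' : (#G + #R₁ : ℚ) ≤ n := by exact_mod_cast h1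
  have h2' : (#G + #R₂ : ℚ) ≤ n := by exact_mod_cast h2
  have : (#R₂ + #R₁ : ℚ) = #R := by exact_mod_cast hcard
  linarith

lemma Covered.sperner (hR : Covered G R) (hG : Sperner G) (hn : 6 ≤ n) :
    Sperner (R.image (fun j => (j, n - 3)) ∪ G.filter fun q => 2 * q.2 ≤ n) := by
  intro p hp q hq hpq
  rw [mem_union, mem_image, mem_filter] at hp hq
  rcases hp with ⟨j, hj, rfl⟩ | ⟨hp, hpn⟩ <;> rcases hq with ⟨k, hk, rfl⟩ | ⟨hq, hqn⟩
  · have : gap j k ≠ 0 := fun h => hpq (by rw [gap_eq_zero h])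
    simp only
    omega
  · exact hR.down j hj q hq
  · have := hR.down k hk p hp
    simp only
    by_contra hlt
    have h0 : gap p.1 k = 0 := by omega
    rw [gap_eq_zero h0, gap_self] at this
    omega
  · exact hG p hp q hq hpq

/-- The gain available for arcs of length `n - 3`. -/
def gain (n : ℕ) : ℚ :=
  if n = 6 then 1 / 6 else if n = 7 then 1 / 4 else if n = 8 then 1 / 10 else 0

lemma gain_nonneg (n : ℕ) : 0 ≤ gain n := by unfold gain; split_ifs <;> norm_num

lemma gain_le (n : ℕ) : gain n ≤ 1 / 4 := by unfold gain; split_ifs <;> norm_num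

lemma Covered.sum_weight_add_gain_le (hR : Covered G R) (hG : Sperner G) (hn : 6 ≤ n)
    (hsize : ∀ q ∈ G, 2 ≤ q.2 ∧ q.2 ≤ n - 2) :
    ∑ q ∈ G, weight n q.2 + gain n * #R ≤ n := by
  classical
  have hM : Meeting G := hR.meeting.mono subset_union_right
  have h0 : ∀ q ∈ G, 0 < q.2 := fun q hq => by have := (hsize q hq).1; omega
  have hbase := sum_weight_le_card hG hM h0
  by_cases hn8 : 8 < n
  · have : gain n = 0 := by unfold gain; split_ifs <;> first | omega | rfl
    simpa [this] using hbase
  rcases R.eq_empty_or_nonempty with rfl | ⟨j₀, hj₀⟩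
  · simpa using hbase
  have hg0 := gain_nonneg n
  have hg4 := gain_le n
  set S := G.filter fun q => 2 * q.2 ≤ n with hSdef
  rcases S.eq_empty_or_nonempty with hS | hS
  · have h1 := hR.card_add_half_card_le hG hn hsize
    have h2 := sum_weight_le (G := G) (n := n) one_pos fun q hq _ => h0 q hq
    rw [← hSdef, hS] at h2
    have : (0 : ℚ) ≤ #R := by positivity
    simp only [card_empty, Nat.cast_zero, zero_mul, add_zero] at h2
    nlinarith
  obtain ⟨a, ha, hmin⟩ := exists_min_image S (fun q => q.2) hS
  have hmin' : ∀ q ∈ G, 2 * q.2 ≤ n → a.2 ≤ q.2 := fun q hq hqn =>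
    hmin q (mem_filter.2 ⟨hq, hqn⟩)
  obtain ⟨haG, han⟩ := mem_filter.1 ha
  have ha2 := (hsize a haG).1
  set R' := R.image (fun j => (j, n - 3)) with hR'
  have hcR' : #R' = #R := card_image_of_injective _ fun j k h => (Prod.ext_iff.1 h).1
  have hH : Sperner (R' ∪ S) := hR.sperner hG hn
  have hHM : Meeting (R' ∪ S) := hR.meeting.mono (union_subset_union_right (filter_subset _ _))
  have haH : a ∈ R' ∪ S := mem_union_right _ ha
  have hdisj : Disjoint R' S := by
    rw [disjoint_left]
    intro p hp hpS
    obtain ⟨j, hj, rfl⟩ := mem_image.1 hp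
    have := hR.down j hj _ (mem_filter.1 hpS).1
    simp at this
  have hRc : #R + #S ≤ 2 * a.2 - 1 := by
    rw [← hcR', ← card_union_of_disjoint hdisj]
    exact card_le_two_mul_sub_one hH hHM haH (by omega)
  have hS1 : 1 ≤ #S := card_pos.2 hS
  have hGc : #G ≤ 2 * a.2 - 1 := card_le_two_mul_sub_one hG hM haG (by omega)
  have hSc : #S ≤ a.2 := card_small_le hG hM haG (by omega)
  rcases (by omega : a.2 = 2 ∨ a.2 = 3 ∨ a.2 = 4) with h2 | h3 | h4
  · have h1 := sum_weight_le_of_two_mem hG hM hn hsize (i := a.1) (by rwa [← h2])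
    have : (#R : ℚ) ≤ 2 := by exact_mod_cast (by omega : #R ≤ 2)
    nlinarith
  · set T := S.filter fun q => q.2 = 3 with hT
    have hRT : #R ≤ (3 - #T) * 2 := by
      have hTH : T ⊆ R' ∪ S := (filter_subset _ _).trans subset_union_right
      have hT3 : ∀ q ∈ T, q.2 = 3 := fun q hq => (mem_filter.1 hq).2
      have inj : Set.InjOn (slot a) (T : Set (Fin n × ℕ)) := fun q hq r hr h =>
        eq_of_slot_eq_of_add_le hH hHM haH (hTH hq) (hTH hr) (by omega) h
          (by rw [hT3 q hq, hT3 r hr]; omega)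
      have sub : T.image (slot a) ⊆ range 3 := by
        intro x hx
        obtain ⟨q, hq, rfl⟩ := mem_image.1 hx
        rw [mem_range, ← h3]
        exact slot_lt hH hHM haH (hTH hq) (by omega)
      have key : #R' ≤ #((range 3 \ T.image (slot a)) ×ˢ (univ : Finset Bool)) := by
        apply card_le_card_of_injOn (fun q => (slot a q, decide (gap a.1 q.1 < a.2)))
        · intro q hq
          have hqH : q ∈ R' ∪ S := mem_union_left _ hq
          simp only [coe_product, Set.mem_prod, mem_coe, mem_univ, and_true, mem_sdiff, mem_range]
          refine ⟨h3 ▸ slot_lt hH hHM haH hqH (by omega), fun hx => ?_⟩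
          obtain ⟨r, hr, hrq⟩ := mem_image.1 hx
          obtain ⟨j, -, rfl⟩ := mem_image.1 hq
          have := eq_of_slot_eq_of_add_le hH hHM haH (hTH hr) hqH (by omega) hrq
            (by rw [hT3 r hr]; simp only; omega)
          rw [this] at hr
          exact disjoint_left.1 hdisj hq (mem_filter.1 hr).1
        · intro q hq r hr h
          rw [Prod.mk.injEq, decide_eq_decide] at h
          exact eq_of_slot_eq hH hHM haH (mem_union_left _ hq) (mem_union_left _ hr) (by omega)
            h.1 h.2
      rwa [hcR', card_product, card_sdiff_of_subset sub, card_image_of_injOn inj, card_range,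
        card_univ, Fintype.card_bool] at key
    have hTc : #T ≤ 3 := (card_filter_le _ _).trans (h3 ▸ hSc)
    have hsplit : #T + #(S.filter fun q => ¬ q.2 = 3) = #S := card_filter_add_card_filter_not _
    have hW : ∑ q ∈ G, weight n q.2 ≤ #G + (#T * ((n + 1) / 3 - 2 : ℚ) +
        #(S.filter fun q => ¬ q.2 = 3) * ((n + 1) / 4 - 2 : ℚ)) := by
      have e : ∀ q ∈ G, weight n q.2 ≤ 1 + if 2 * q.2 ≤ n then
          (if q.2 = 3 then ((n + 1) / 3 - 2 : ℚ) else ((n + 1) / 4 - 2 : ℚ)) else 0 := by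
        intro q hq
        unfold weight
        split_ifs with hs h3
        · rw [h3]; norm_num; linarith
        · have := hmin' q hq hs
          rw [show q.2 = 4 by omega]
          norm_num; linarith
        · simp
      refine (sum_le_sum e).trans_eq ?_
      rw [sum_add_distrib, ← sum_filter, sum_ite]
      simp only [sum_const, nsmul_eq_mul, mul_one, ← hSdef, ← hT]
    set t := #(S.filter fun q => ¬ q.2 = 3)
    have q1 : (#G : ℚ) ≤ 5 := by exact_mod_cast (by omega : #G ≤ 5)
    have q2 : (#R : ℚ) ≤ 6 - 2 * #T := by
      have : #R + 2 * #T ≤ 6 := by omega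
      have : (#R : ℚ) + 2 * #T ≤ 6 := by exact_mod_cast this
      linarith
    have q3 : (#T + t : ℚ) ≤ 3 := by exact_mod_cast (by omega : #T + t ≤ 3)
    have q4 : (0 : ℚ) ≤ t := by positivity
    obtain rfl | rfl | rfl : n = 6 ∨ n = 7 ∨ n = 8 := by omega
    all_goals
      norm_num [gain] at hW ⊢
      linarith
  · obtain rfl : n = 8 := by omega
    obtain ⟨i, hi, -, -⟩ := hR.up j₀ hj₀
    have c1 := hG.card_add_le hi haG (by simp only; omega) (by simp)
    have hW := sum_weight_le (G := G) (n := 8) (k := 4) (by norm_num) (by rwa [h4] at hmin')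
    have q1 : (#G : ℚ) ≤ 6 := by exact_mod_cast (by simp only at c1; omega : #G ≤ 6)
    have q2 : (#R : ℚ) ≤ 6 := by exact_mod_cast (by omega : #R ≤ 6)
    have q3 : (#S : ℚ) ≤ 4 := by exact_mod_cast (by omega : #S ≤ 4)
    rw [← hSdef] at hW
    norm_num [gain] at hW ⊢
    linarith

end Arcs

open Nat in
lemma add_mul_succ_mul_factorial_le {a d : ℕ} (ha : 2 ≤ a) (hd : 1 ≤ d) :
    (a + d) * (d + 1) * (a ! * d !) ≤ 2 * (a + d)! := by
  induction d, hd using Nat.le_induction with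
  | base =>
    rw [Nat.factorial_one, Nat.factorial_succ]
    exact le_of_eq (by ring)
  | succ d hd ih =>
    have h : (d + 2) * (a ! * (d + 1)!) ≤ 2 * (a + d)! := by
      refine le_trans ?_ ih
      rw [Nat.factorial_succ]
      calc (d + 2) * (a ! * ((d + 1) * d !)) ≤ (a + d) * (a ! * ((d + 1) * d !)) :=
            Nat.mul_le_mul_right _ (by omega)
        _ = _ := by ring
    rw [← add_assoc, Nat.factorial_succ (a + d)]
    calc _ = (a + d + 1) * ((d + 2) * (a ! * (d + 1)!)) := by ring
      _ ≤ (a + d + 1) * (2 * (a + d)!) := by gcongr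
      _ = _ := by ring

section Permutations

variable {α : Type*} [Fintype α] [DecidableEq α]

lemma card_perm_comp_eq_le {ι : Type*} [Fintype ι] [DecidableEq ι] (f g : α → ι) :
    #{σ : Equiv.Perm α | f ∘ σ = g} ≤ ∏ i, (#{x | f x = i}).factorial := by
  rcases ({σ : Equiv.Perm α | f ∘ σ = g} : Finset _).eq_empty_or_nonempty with h | ⟨τ, hτ⟩
  · rw [h]; simp
  · have hs := DomMulAct.stabilizer_card f
    simp only [Fintype.card_subtype] at hs
    rw [← hs]
    apply card_le_card_of_injOn (fun σ => σ * τ⁻¹)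
    · intro σ hσ
      simp only [coe_filter, mem_univ, true_and, Set.mem_ofPred_eq, mem_filter] at hσ hτ ⊢
      rw [Equiv.Perm.coe_mul, ← Function.comp_assoc, hσ, ← hτ, Function.comp_assoc,
        ← Equiv.Perm.coe_mul, mul_inv_cancel, Equiv.Perm.coe_one, Function.comp_id]
    · intro σ _ ρ _ h
      exact mul_right_cancel h

lemma card_perm_image_chain_le {A A' B B' : Finset α} (hAB : A ⊆ B) :
    #{σ : Equiv.Perm α | A'.image σ = A ∧ B'.image σ = B} ≤
      (#A).factorial * (#B - #A).factorial * (Fintype.card α - #B).factorial := by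
  classical
  set f : Finset α → Finset α → α → Fin 3 := fun A B x =>
    if x ∈ A then 0 else if x ∈ B then 1 else 2
  calc _ ≤ #{σ : Equiv.Perm α | f A B ∘ σ = f A' B'} := by
        apply card_le_card
        intro σ
        simp only [mem_filter, mem_univ, true_and]
        rintro ⟨rfl, rfl⟩
        funext x
        simp [f]
    _ ≤ _ := card_perm_comp_eq_le _ _
    _ = _ := by
        rw [Fin.prod_univ_three]
        have h0 : ({x | f A B x = 0} : Finset α) = A := by
          ext x; simp only [f, mem_filter, mem_univ, true_and]; split_ifs <;> simp_all
        have h1 : ({x | f A B x = 1} : Finset α) = B \ A := by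
          ext x; simp only [f, mem_filter, mem_univ, true_and, mem_sdiff]; split_ifs <;> simp_all
        have h2 : ({x | f A B x = 2} : Finset α) = Bᶜ := by
          ext x; simp only [f, mem_filter, mem_univ, true_and, mem_compl]
          have := @hAB x
          split_ifs <;> simp_all
        rw [h0, h1, h2, card_sdiff_of_subset hAB, card_compl]

lemma card_perm_image_eq {A B : Finset α} (h : #A = #B) :
    #{σ : Equiv.Perm α | A.image σ = B} =
      (#B).factorial * (Fintype.card α - #B).factorial := by
  have le : ∀ C ∈ powersetCard #A univ, #{σ : Equiv.Perm α | A.image σ = C} ≤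
      (#A).factorial * (Fintype.card α - #A).factorial := by
    intro C hC
    have := card_perm_image_chain_le (A := ∅) (A' := ∅) (B := C) (B' := A) (empty_subset _)
    rw [mem_powersetCard_univ] at hC
    simpa [hC] using this
  have hsum : ∑ C ∈ powersetCard #A univ, #{σ : Equiv.Perm α | A.image σ = C} =
      ∑ C ∈ powersetCard #A (univ : Finset α),
        (#A).factorial * (Fintype.card α - #A).factorial := by
    rw [← card_eq_sum_card_fiberwise (fun σ _ => by
      simp [card_image_of_injective _ (Equiv.injective _)])]
    rw [sum_const, card_powersetCard, smul_eq_mul, ← mul_assoc, card_univ, card_univ,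
      Fintype.card_perm, Nat.choose_mul_factorial_mul_factorial (card_le_univ _)]
  rw [(sum_eq_sum_iff_of_le le).1 hsum B (by rw [mem_powersetCard_univ, h]), h]

end Permutations

section Counting

open Nat

variable {n : ℕ}

/-- The arcs of length between `2` and `n - 2`, given by starting point and length. -/
def arcs (n : ℕ) : Finset (Fin n × ℕ) := univ ×ˢ Icc 2 (n - 2)

lemma mem_arcs {p : Fin n × ℕ} : p ∈ arcs n ↔ 2 ≤ p.2 ∧ p.2 ≤ n - 2 := by simp [arcs]

/-- The image of an arc under a permutation of the circle. -/
def arcImage (σ : Equiv.Perm (Fin n)) (p : Fin n × ℕ) : Finset (Fin n) := (arc p.1 p.2).image σ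

lemma card_arcImage (σ : Equiv.Perm (Fin n)) {p : Fin n × ℕ} (hp : p ∈ arcs n) :
    #(arcImage σ p) = p.2 := by
  rw [mem_arcs] at hp
  rw [arcImage, card_image_of_injective _ σ.injective, card_arc _ (by omega)]

lemma arcImage_mono (σ : Equiv.Perm (Fin n)) {p q : Fin n × ℕ} (h : gap p.1 q.1 + q.2 ≤ p.2) :
    arcImage σ q ⊆ arcImage σ p := image_subset_image (arc_subset_arc h)

lemma arcImage_ssubset (σ : Equiv.Perm (Fin n)) {p q : Fin n × ℕ} (hp : p ∈ arcs n)
    (hq : q ∈ arcs n) (hne : q ≠ p) (h : gap p.1 q.1 + q.2 ≤ p.2) :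
    arcImage σ q ⊂ arcImage σ p := by
  refine (arcImage_mono σ h).ssubset_of_ne fun he => hne ?_
  have hc := congrArg card he
  rw [card_arcImage σ hp, card_arcImage σ hq] at hc
  exact Prod.ext (gap_eq_zero (by omega)).symm hc

/-- All pairs of a permutation of the circle and an arc. -/
def permArcs (n : ℕ) : Finset (Equiv.Perm (Fin n) × (Fin n × ℕ)) := univ ×ˢ arcs n

lemma card_permArcs_eq {S : Finset (Fin n)} (h₂ : 2 ≤ #S) (hn : #S ≤ n - 2) :
    #{z ∈ permArcs n | arcImage z.1 z.2 = S} = n * ((#S)! * (n - #S)!) := by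
  rw [card_eq_sum_card_fiberwise (f := fun z => z.2.1) (t := univ) (fun _ _ => by simp)]
  rw [sum_congr rfl (g := fun _ => (#S)! * (n - #S)!), sum_const,
    Finset.card_univ, Fintype.card_fin, smul_eq_mul]
  intro i _
  have := card_perm_image_eq (A := arc i #S) (B := S) (card_arc i (by omega))
  rw [Fintype.card_fin] at this
  rw [← this, ← card_image_of_injective (f := fun σ : Equiv.Perm (Fin n) => (σ, (i, #S))) _
    fun σ τ h => (Prod.ext_iff.1 h).1]
  congr 1
  ext ⟨σ, j, s⟩
  simp only [mem_filter, mem_image, mem_univ, true_and, permArcs, mem_product, Prod.mk.injEq,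
    mem_arcs]
  constructor
  · rintro ⟨⟨hs, h⟩, rfl⟩
    have := card_arcImage (p := (j, s)) σ (mem_arcs.2 hs)
    rw [h] at this
    simp only at this
    subst this
    exact ⟨σ, h, rfl, rfl, rfl⟩
  · rintro ⟨τ, h, rfl, rfl, rfl⟩
    exact ⟨⟨⟨h₂, hn⟩, h⟩, rfl⟩

lemma card_gap_lt (n d : ℕ) : #{t : Fin n × Fin n | gap t.1 t.2 < d} ≤ n * d := by
  calc _ ≤ #((univ : Finset (Fin n)) ×ˢ range d) := by
        apply card_le_card_of_injOn (fun t => (t.1, gap t.1 t.2))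
        · intro t ht
          simpa using ht
        · rintro ⟨i, j⟩ _ ⟨k, l⟩ _ h
          obtain ⟨rfl, h⟩ := Prod.ext_iff.1 h
          exact Prod.ext rfl (gap_injective i h)
    _ = n * d := by simp

lemma card_pairs_le {A B : Finset (Fin n)} (hAB : A ⊆ B) (f : Fin n × Fin n → Fin n × ℕ) :
    #((univ.filter fun t : Fin n × Fin n => gap t.1 t.2 < #B - #A + 1).biUnion fun t =>
      (univ.filter fun σ : Equiv.Perm (Fin n) =>
        (arc t.2 #A).image σ = A ∧ (arc t.1 #B).image σ = B).image fun σ => (σ, f t)) ≤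
      n * (#B - #A + 1) * ((#A)! * (#B - #A)! * (n - #B)!) := by
  refine (card_biUnion_le_card_mul _ _ _ fun t _ => card_image_le.trans
    (card_perm_image_chain_le hAB)).trans ?_
  rw [Fintype.card_fin]
  exact Nat.mul_le_mul_right _ (card_gap_lt _ _)

/-- `p` is an arc properly containing an arc whose image belongs to `F`. -/
def Nests (F : Finset (Finset (Fin n))) (σ : Equiv.Perm (Fin n)) (p : Fin n × ℕ) : Prop :=
  ∃ q ∈ arcs n, q ≠ p ∧ gap p.1 q.1 + q.2 ≤ p.2 ∧ arcImage σ q ∈ F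

/-- `p` is an arc properly contained in an arc whose image belongs to `F`. -/
def Nested (F : Finset (Finset (Fin n))) (σ : Equiv.Perm (Fin n)) (p : Fin n × ℕ) : Prop :=
  ∃ q ∈ arcs n, q ≠ p ∧ gap q.1 p.1 + p.2 ≤ q.2 ∧ arcImage σ q ∈ F

open Classical in
lemma card_nests_le {F : Finset (Finset (Fin n))} {A B : Finset (Fin n)} (hAB : A ⊂ B)
    (hA : 2 ≤ #A) (huniq : ∀ A' ∈ F, A' ⊂ B → A' = A) :
    #B * #{z ∈ permArcs n | arcImage z.1 z.2 = B ∧ Nests F z.1 z.2} ≤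
      2 * (n * ((#B)! * (n - #B)!)) := by
  have hlt := card_lt_card hAB
  have h : #{z ∈ permArcs n | arcImage z.1 z.2 = B ∧ Nests F z.1 z.2} ≤
      n * (#B - #A + 1) * ((#A)! * (#B - #A)! * (n - #B)!) := by
    refine le_trans (card_le_card ?_) (card_pairs_le hAB.1 fun t => (t.1, #B))
    rintro ⟨σ, p⟩ hz
    simp only [mem_filter, permArcs, mem_product, mem_univ, true_and] at hz
    obtain ⟨hp, hB, q, hq, hne, hgap, hqF⟩ := hz
    have hqA := huniq _ hqF (hB ▸ arcImage_ssubset σ hp hq hne hgap)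
    have c1 := card_arcImage σ hp
    have c2 := card_arcImage σ hq
    rw [hB] at c1
    rw [hqA] at c2
    simp only [mem_biUnion, mem_filter, mem_univ, true_and, mem_image]
    refine ⟨(p.1, q.1), by simp only; omega, σ, ⟨?_, ?_⟩, ?_⟩
    · rw [c2]; exact hqA
    · rw [c1]; exact hB
    · simp [c1]
  have key := add_mul_succ_mul_factorial_le hA (show 1 ≤ #B - #A by omega)
  rw [Nat.add_sub_cancel' hlt.le] at key
  calc _ ≤ #B * (n * (#B - #A + 1) * ((#A)! * (#B - #A)! * (n - #B)!)) := by gcongr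
    _ = n * (n - #B)! * (#B * (#B - #A + 1) * ((#A)! * (#B - #A)!)) := by ring
    _ ≤ n * (n - #B)! * (2 * (#B)!) := by gcongr
    _ = _ := by ring

open Classical in
lemma card_nested_le {F : Finset (Finset (Fin n))} {B C : Finset (Fin n)} (hBC : B ⊂ C)
    (hC : 2 ≤ n - #C) (huniq : ∀ C' ∈ F, B ⊂ C' → C' = C) :
    (n - #B) * #{z ∈ permArcs n | arcImage z.1 z.2 = B ∧ Nested F z.1 z.2} ≤
      2 * (n * ((#B)! * (n - #B)!)) := by
  have hlt := card_lt_card hBC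
  have h : #{z ∈ permArcs n | arcImage z.1 z.2 = B ∧ Nested F z.1 z.2} ≤
      n * (#C - #B + 1) * ((#B)! * (#C - #B)! * (n - #C)!) := by
    refine le_trans (card_le_card ?_) (card_pairs_le hBC.1 fun t => (t.2, #B))
    rintro ⟨σ, p⟩ hz
    simp only [mem_filter, permArcs, mem_product, mem_univ, true_and] at hz
    obtain ⟨hp, hB, q, hq, hne, hgap, hqF⟩ := hz
    have hqC := huniq _ hqF (hB ▸ arcImage_ssubset σ hq hp hne.symm hgap)
    have c1 := card_arcImage σ hp
    have c2 := card_arcImage σ hq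
    rw [hB] at c1
    rw [hqC] at c2
    simp only [mem_biUnion, mem_filter, mem_univ, true_and, mem_image]
    refine ⟨(q.1, p.1), by simp only; omega, σ, ⟨?_, ?_⟩, ?_⟩
    · rw [c1]; exact hB
    · rw [c2]; exact hqC
    · simp [c1]
  have key := add_mul_succ_mul_factorial_le hC (show 1 ≤ #C - #B by omega)
  rw [show n - #C + (#C - #B) = n - #B by omega] at key
  calc _ ≤ (n - #B) * (n * (#C - #B + 1) * ((#B)! * (#C - #B)! * (n - #C)!)) := by gcongr
    _ = n * (#B)! * ((n - #B) * (#C - #B + 1) * ((n - #C)! * (#C - #B)!)) := by ring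
    _ ≤ n * (#B)! * (2 * (n - #B)!) := by gcongr
    _ = _ := by ring

variable {F : Finset (Finset (Fin n))}

lemma _root_.ButterflyFree.above_unique {α : Type*} {F : Finset (Finset α)} {A B C D : Finset α}
    (hF : ButterflyFree F) (hA : A ∈ F) (hB : B ∈ F) (hC : C ∈ F) (hD : D ∈ F) (hAB : A ⊂ B)
    (hBC : B ⊂ C) (hBD : B ⊂ D) : C = D := by
  by_contra hCD
  exact hF ⟨A, B, C, D, hA, hB, hC, hD, hAB.ne, (hAB.trans hBC).ne, (hAB.trans hBD).ne,
    hBC.ne, hBD.ne, hCD, (hAB.trans hBC).1, (hAB.trans hBD).1, hBC.1, hBD.1⟩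

lemma _root_.ButterflyFree.below_unique {α : Type*} {F : Finset (Finset α)} {A B C D : Finset α}
    (hF : ButterflyFree F) (hA : A ∈ F) (hB : B ∈ F) (hC : C ∈ F) (hD : D ∈ F) (hAC : A ⊂ C)
    (hBC : B ⊂ C) (hCD : C ⊂ D) : A = B := by
  by_contra hAB
  exact hF ⟨A, B, C, D, hA, hB, hC, hD, hAB, hAC.ne, (hAC.trans hCD).ne, hBC.ne,
    (hBC.trans hCD).ne, hCD.ne, hAC.1, (hAC.trans hCD).1, hBC.1, (hBC.trans hCD).1⟩

/-- Some member of `F` is properly contained in `B`. -/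
def HasBelow (F : Finset (Finset (Fin n))) (B : Finset (Fin n)) : Prop := ∃ A ∈ F, A ⊂ B

/-- Some member of `F` properly contains `B`. -/
def HasAbove (F : Finset (Finset (Fin n))) (B : Finset (Fin n)) : Prop := ∃ C ∈ F, B ⊂ C

variable {σ : Equiv.Perm (Fin n)} {p : Fin n × ℕ}

lemma Nests.hasBelow (h : Nests F σ p) (hp : p ∈ arcs n) : HasBelow F (arcImage σ p) := by
  obtain ⟨q, hq, hne, hgap, hqF⟩ := h
  exact ⟨_, hqF, arcImage_ssubset σ hp hq hne hgap⟩

lemma Nested.hasAbove (h : Nested F σ p) (hp : p ∈ arcs n) : HasAbove F (arcImage σ p) := by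
  obtain ⟨q, hq, hne, hgap, hqF⟩ := h
  exact ⟨_, hqF, arcImage_ssubset σ hq hp hne.symm hgap⟩

lemma meeting_of_intersecting (hF : Intersecting F) {G : Finset (Fin n × ℕ)}
    (hG : ∀ p ∈ G, arcImage σ p ∈ F) : Meeting G := by
  intro p hp q hq h
  by_contra hlt
  obtain ⟨x, hx⟩ := hF _ (hG p hp) _ (hG q hq)
  rw [arcImage, arcImage, ← image_inter _ _ σ.injective,
    disjoint_iff_inter_eq_empty.1 (disjoint_arc h (not_lt.1 hlt))] at hx
  simp at hx

lemma arcImage_left_injective {i j : Fin n} {s : ℕ} (hs : (i, s) ∈ arcs n)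
    (h : arcImage σ (i, s) = arcImage σ (j, s)) : i = j := by
  rw [mem_arcs] at hs
  exact arc_left_injective (by simp only at hs; omega) (by simp only at hs; omega)
    (image_injective σ.injective h)

open Classical in
/-- The arcs that are minimal among those with image in `F`, without the maximal members. -/
noncomputable def lowerArcs (F : Finset (Finset (Fin n))) (σ : Equiv.Perm (Fin n)) :
    Finset (Fin n × ℕ) :=
  {p ∈ arcs n | arcImage σ p ∈ F ∧ HasAbove F (arcImage σ p) ∧ ¬ Nests F σ p}

open Classical in
/-- The arcs that are maximal among those with image in `F`, without the minimal members that
are not maximal. -/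
noncomputable def upperArcs (F : Finset (Finset (Fin n))) (σ : Equiv.Perm (Fin n)) :
    Finset (Fin n × ℕ) :=
  {p ∈ arcs n | arcImage σ p ∈ F ∧ (HasAbove F (arcImage σ p) → HasBelow F (arcImage σ p)) ∧
    ¬ Nested F σ p}

lemma mem_lowerArcs : p ∈ lowerArcs F σ ↔
    p ∈ arcs n ∧ arcImage σ p ∈ F ∧ HasAbove F (arcImage σ p) ∧ ¬ Nests F σ p := by
  simp [lowerArcs]

lemma mem_upperArcs : p ∈ upperArcs F σ ↔ p ∈ arcs n ∧ arcImage σ p ∈ F ∧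
    (HasAbove F (arcImage σ p) → HasBelow F (arcImage σ p)) ∧ ¬ Nested F σ p := by
  simp [upperArcs]

lemma sperner_lowerArcs : Sperner (lowerArcs F σ) := by
  intro p hp q hq hne
  rw [mem_lowerArcs] at hp hq
  by_contra hlt
  exact hp.2.2.2 ⟨q, hq.1, hne.symm, not_lt.1 hlt, hq.2.1⟩

lemma sperner_upperArcs : Sperner (upperArcs F σ) := by
  intro p hp q hq hne
  rw [mem_upperArcs] at hp hq
  by_contra hlt
  exact hq.2.2.2 ⟨p, hp.1, hne, not_lt.1 hlt, hp.2.1⟩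

open Classical in
lemma sum_weight_lowerArcs_le (hI : Intersecting F) (hB : ButterflyFree F)
    (hsize : ∀ A ∈ F, 2 ≤ #A ∧ #A ≤ n - 2) :
    ∑ p ∈ lowerArcs F σ, weight n p.2 + #{p ∈ arcs n | p.2 = 3 ∧ arcImage σ p ∈ F ∧
      HasAbove F (arcImage σ p) ∧ Nests F σ p} / 2 ≤ n := by
  have hS : Sperner (lowerArcs F σ) := sperner_lowerArcs
  have hM : Meeting (lowerArcs F σ) :=
    meeting_of_intersecting hI fun p hp => (mem_lowerArcs.1 hp).2.1
  have hs : ∀ q ∈ lowerArcs F σ, 2 ≤ q.2 ∧ q.2 ≤ n - 2 := fun q hq =>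
    mem_arcs.1 (mem_lowerArcs.1 hq).1
  set Q := {p ∈ arcs n | p.2 = 3 ∧ arcImage σ p ∈ F ∧
      HasAbove F (arcImage σ p) ∧ Nests F σ p} with hQdef
  rcases Q.eq_empty_or_nonempty with hQ | ⟨p₀, hp₀⟩
  · rw [hQ]
    simpa using sum_weight_le_card hS hM fun q hq => by have := hs q hq; omega
  have hn : 6 ≤ n := by
    obtain ⟨hp, hp3, -, ⟨C, hC, hlt⟩, -⟩ := mem_filter.1 hp₀
    have := card_lt_card hlt
    rw [card_arcImage σ hp] at this
    have := hsize C hC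
    omega
  rw [← card_image_of_injOn (f := Prod.fst) (s := Q) fun p hp q hq h =>
    Prod.ext h ((mem_filter.1 hp).2.1.trans (mem_filter.1 hq).2.1.symm)]
  refine sum_weight_add_half_card_le hS hM hn hs fun j hj => ?_
  obtain ⟨⟨j, s⟩, hp, rfl⟩ := mem_image.1 hj
  obtain ⟨hp, rfl, hpF, ⟨C, hC, hpC⟩, q, hq, hne, hgap, hqF⟩ := mem_filter.1 hp
  have hq2 := mem_arcs.1 hq
  have hne' : ¬ (gap j q.1 = 0 ∧ q.2 = 3) := fun h =>
    hne (Prod.ext (gap_eq_zero h.1).symm h.2)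
  simp only at hgap ⊢
  have hq' : q = (q.1, 2) := Prod.ext rfl (by simp only; omega)
  have hsub := arcImage_ssubset σ hp hq hne hgap
  refine ⟨q.1, ?_, by omega, fun i hi hgap' => ?_⟩
  · rw [← hq', mem_lowerArcs]
    refine ⟨hq, hqF, ⟨_, hpF, hsub⟩, ?_⟩
    rintro ⟨r, hr, hrne, hrgap, -⟩
    have := (mem_arcs.1 hr).1
    exact hrne (Prod.ext (gap_eq_zero (by omega)).symm (by omega))
  · obtain ⟨hi, hiF, -, -⟩ := mem_lowerArcs.1 hi
    have hsub' := arcImage_ssubset σ hp hi (by simp) (by simp only; omega)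
    have := hB.below_unique hiF hqF hpF hC hsub' hsub hpC
    rw [hq'] at this
    exact arcImage_left_injective hi this

open Classical in
lemma sum_weight_upperArcs_le (hI : Intersecting F) (hB : ButterflyFree F) :
    ∑ p ∈ upperArcs F σ, weight n p.2 + gain n * #{p ∈ arcs n | p.2 = n - 3 ∧ arcImage σ p ∈ F ∧
      (HasAbove F (arcImage σ p) → HasBelow F (arcImage σ p)) ∧ Nested F σ p} ≤ n := by
  have hS : Sperner (upperArcs F σ) := sperner_upperArcs
  have hs : ∀ q ∈ upperArcs F σ, 2 ≤ q.2 ∧ q.2 ≤ n - 2 := fun q hq =>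
    mem_arcs.1 (mem_upperArcs.1 hq).1
  set R := {p ∈ arcs n | p.2 = n - 3 ∧ arcImage σ p ∈ F ∧
      (HasAbove F (arcImage σ p) → HasBelow F (arcImage σ p)) ∧ Nested F σ p} with hRdef
  rcases lt_or_ge n 6 with hn | hn
  · have hM : Meeting (upperArcs F σ) :=
      meeting_of_intersecting hI fun p hp => (mem_upperArcs.1 hp).2.1
    have : gain n = 0 := by unfold gain; split_ifs <;> first | omega | rfl
    simpa [this] using sum_weight_le_card hS hM fun q hq => by have := hs q hq; omega
  have inj : Set.InjOn Prod.fst (R : Set (Fin n × ℕ)) := fun p hp q hq h =>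
    Prod.ext h ((mem_filter.1 hp).2.1.trans (mem_filter.1 hq).2.1.symm)
  have hR : ∀ j ∈ R.image Prod.fst, (j, n - 3) ∈ R := by
    intro j hj
    obtain ⟨p, hp, rfl⟩ := mem_image.1 hj
    rwa [← (mem_filter.1 hp).2.1]
  rw [← Finset.card_image_of_injOn inj]
  refine Covered.sum_weight_add_gain_le ⟨fun j hj => ?_, fun j hj p hp => ?_, ?_⟩ hS hn hs
  · obtain ⟨hp, -, hpF, hAB, hN⟩ := mem_filter.1 (hR j hj)
    obtain ⟨A, hA, hAp⟩ := hAB (hN.hasAbove hp)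
    obtain ⟨q, hq, hne, hgap, hqF⟩ := hN
    have hq2 := mem_arcs.1 hq
    have hne' : ¬ (gap q.1 j = 0 ∧ q.2 = n - 3) := fun h =>
      hne (Prod.ext (gap_eq_zero h.1) h.2)
    simp only at hgap
    have hq' : q = (q.1, n - 2) := Prod.ext rfl (by simp only; omega)
    have hsub := arcImage_ssubset σ hq hp hne.symm hgap
    refine ⟨q.1, ?_, by omega, fun i hi hgap' => ?_⟩
    · rw [← hq', mem_upperArcs]
      refine ⟨hq, hqF, fun _ => ⟨_, hpF, hsub⟩, ?_⟩
      rintro ⟨r, hr, hrne, hrgap, -⟩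
      have := (mem_arcs.1 hr).2
      exact hrne (Prod.ext (gap_eq_zero (by omega)) (by omega))
    · obtain ⟨hi, hiF, -, -⟩ := mem_upperArcs.1 hi
      have hsub' := arcImage_ssubset (p := (i, n - 2)) σ hi hp
        (fun h => by have := (Prod.ext_iff.1 h).2; simp only at this; omega)
        (by simp only; omega)
      have := hB.above_unique hA hpF hiF hqF hAp hsub' hsub
      rw [hq'] at this
      exact arcImage_left_injective hi this
  · obtain ⟨hj, -, hjF, -, hN⟩ := mem_filter.1 (hR j hj)
    obtain ⟨-, -, -, hpN⟩ := mem_upperArcs.1 hp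
    by_contra hlt
    refine hpN ⟨_, hj, ?_, not_lt.1 hlt, hjF⟩
    rintro rfl
    exact hpN hN
  · refine meeting_of_intersecting (σ := σ) hI fun p hp => ?_
    rcases mem_union.1 hp with hp | hp
    · obtain ⟨j, hj, rfl⟩ := mem_image.1 hp
      exact (mem_filter.1 (hR j hj)).2.2.1
    · exact (mem_upperArcs.1 hp).2.1

open Classical in
/-- The weight of an arc, counted twice if its image `B` is neither minimal nor maximal in `F`,
and then discounted for each neighbour of `B` that the circle sees. -/
noncomputable def charge (F : Finset (Finset (Fin n))) (σ : Equiv.Perm (Fin n))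
    (p : Fin n × ℕ) : ℚ :=
  weight n p.2 + if HasBelow F (arcImage σ p) ∧ HasAbove F (arcImage σ p) then
    weight n p.2 - (if Nests F σ p then weight n p.2 - (if p.2 = 3 then 1 / 2 else 0) else 0) -
      (if Nested F σ p then weight n p.2 - (if p.2 = n - 3 then gain n else 0) else 0) else 0

lemma sum_charge_le (hI : Intersecting F) (hB : ButterflyFree F)
    (hsize : ∀ A ∈ F, 2 ≤ #A ∧ #A ≤ n - 2) :
    ∑ p ∈ arcs n with arcImage σ p ∈ F, charge F σ p ≤ 2 * n := by
  classical
  have hl := sum_weight_lowerArcs_le (σ := σ) hI hB hsize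
  have hu := sum_weight_upperArcs_le (σ := σ) hI hB
  have e : ∑ p ∈ arcs n with arcImage σ p ∈ F, charge F σ p =
      (∑ p ∈ lowerArcs F σ, weight n p.2 + #{p ∈ arcs n | p.2 = 3 ∧ arcImage σ p ∈ F ∧
        HasAbove F (arcImage σ p) ∧ Nests F σ p} / 2) +
      (∑ p ∈ upperArcs F σ, weight n p.2 + gain n * #{p ∈ arcs n | p.2 = n - 3 ∧
        arcImage σ p ∈ F ∧ (HasAbove F (arcImage σ p) → HasBelow F (arcImage σ p)) ∧
        Nested F σ p}) := by
    rw [lowerArcs, upperArcs, card_filter, card_filter, Nat.cast_sum, Nat.cast_sum, sum_div,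
      mul_sum, sum_filter, sum_filter, sum_filter, ← sum_add_distrib, ← sum_add_distrib,
      ← sum_add_distrib]
    refine sum_congr rfl fun p hp => ?_
    have h1 : Nests F σ p → HasBelow F (arcImage σ p) := fun h => h.hasBelow hp
    have h2 : Nested F σ p → HasAbove F (arcImage σ p) := fun h => h.hasAbove hp
    have i3 : (if p.2 = 3 then 1 / 2 else 0 : ℚ) = (if p.2 = 3 then 1 else 0) / 2 := by
      split_ifs <;> simp
    have i6 : (if p.2 = n - 3 then gain n else 0) = gain n * (if p.2 = n - 3 then 1 else 0) := by
      split_ifs <;> simp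
    rw [charge, i3, i6]
    by_cases hF : arcImage σ p ∈ F <;> by_cases c1 : Nests F σ p <;>
      by_cases c2 : Nested F σ p <;> by_cases c3 : HasBelow F (arcImage σ p) <;>
      by_cases c4 : HasAbove F (arcImage σ p) <;>
      simp only [hF, c1, c2, c3, c4, forall_const, imp_false, not_true] at h1 h2 ⊢ <;>
      simp <;> ring
  rw [e]
  linarith

/-- With `b = #B`, `x` and `y` the proportions of the arcs with image `B` that see the lower and
the upper neighbour of `B`. -/
lemma discount_le {n b : ℕ} (hb : 3 ≤ b) (hbn : b + 3 ≤ n) {t x y : ℚ} (hx : b * x ≤ 2 * t)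
    (hy : (n - b) * y ≤ 2 * t) (hx0 : 0 ≤ x) (hy0 : 0 ≤ y) :
    x * (weight n b - (if b = 3 then 1 / 2 else 0)) +
      y * (weight n b - (if b = n - 3 then gain n else 0)) ≤ t * weight n b := by
  have hb' : (3 : ℚ) ≤ b := by exact_mod_cast hb
  have hbn' : (b : ℚ) + 3 ≤ n := by exact_mod_cast hbn
  have ht : 0 ≤ t := by nlinarith
  rcases lt_or_ge n 9 with hn | hn
  · have hb5 : b ≤ 5 := by omega
    interval_cases b <;> interval_cases n <;> norm_num [weight, gain] at hx hy ⊢ <;> linarith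
  · have hn' : (9 : ℚ) ≤ n := by exact_mod_cast hn
    have hw : 0 ≤ weight n b := by
      unfold weight
      split_ifs
      · rw [sub_nonneg, le_div_iff₀ (by linarith)]; linarith
      · norm_num
    have hx' : x ≤ 2 / b * t := by
      rw [div_mul_eq_mul_div, le_div_iff₀ (by linarith)]; linarith
    have hy' : y ≤ 2 / (n - b) * t := by
      rw [div_mul_eq_mul_div, le_div_iff₀ (by linarith)]; linarith
    have hsum : (2 / b + 2 / (n - b) : ℚ) ≤ 1 := by
      rw [div_add_div _ _ (by linarith) (by linarith), div_le_one (by nlinarith)]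
      nlinarith
    have hxy : x + y ≤ t := by nlinarith
    have g1 : (0 : ℚ) ≤ if b = 3 then 1 / 2 else 0 := by split_ifs <;> norm_num
    have g2 : 0 ≤ if b = n - 3 then gain n else 0 := by
      split_ifs
      exacts [gain_nonneg n, le_rfl]
    nlinarith [mul_nonneg hx0 g1, mul_nonneg hy0 g2, mul_le_mul_of_nonneg_right hxy hw]

lemma le_sum_charge (hB : ButterflyFree F) (hsize : ∀ A ∈ F, 2 ≤ #A ∧ #A ≤ n - 2)
    {S : Finset (Fin n)} (hS : S ∈ F) :
    (n * ((#S)! * (n - #S)!) : ℕ) * weight n #S ≤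
      ∑ z ∈ permArcs n with arcImage z.1 z.2 = S, charge F z.1 z.2 := by
  classical
  have htot := card_permArcs_eq (hsize S hS).1 (hsize S hS).2
  set Z := {z ∈ permArcs n | arcImage z.1 z.2 = S} with hZ
  have hz : ∀ z ∈ Z, arcImage z.1 z.2 = S ∧ z.2.2 = #S := by
    intro z hz
    obtain ⟨hzn, hzS⟩ := mem_filter.1 hz
    exact ⟨hzS, by rw [← hzS, card_arcImage _ (mem_product.1 hzn).2]⟩
  by_cases hmid : HasBelow F S ∧ HasAbove F S
  · rw [sum_congr rfl (g := fun z : Equiv.Perm (Fin n) × (Fin n × ℕ) =>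
      weight n #S + (weight n #S - (if Nests F z.1 z.2 then
        weight n #S - (if #S = 3 then 1 / 2 else 0) else 0) - (if Nested F z.1 z.2 then
        weight n #S - (if #S = n - 3 then gain n else 0) else 0))) fun z h => by
      rw [charge, (hz z h).1, (hz z h).2, if_pos hmid]]
    rw [sum_add_distrib, sum_sub_distrib, sum_sub_distrib, ← sum_filter, ← sum_filter]
    simp only [sum_const, nsmul_eq_mul, htot]
    obtain ⟨⟨A, hA, hAS⟩, C, hC, hSC⟩ := hmid
    have s1 := hsize A hA
    have s2 := hsize C hC
    have s3 := card_lt_card hAS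
    have s4 := card_lt_card hSC
    have hX := card_nests_le hAS s1.1 fun A' hA' h => hB.below_unique hA' hA hS hC h hAS hSC
    have hY := card_nested_le hSC (by omega) fun C' hC' h => hB.above_unique hA hS hC' hC hAS h hSC
    rw [← filter_filter, ← hZ] at hX hY
    have hX' := (Nat.cast_le (α := ℚ)).2 hX
    have hY' := (Nat.cast_le (α := ℚ)).2 hY
    rw [Nat.cast_mul, Nat.cast_mul 2] at hX' hY'
    rw [Nat.cast_sub (by omega)] at hY'
    have := discount_le (by omega) (by omega) hX' hY' (Nat.cast_nonneg _) (Nat.cast_nonneg _)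
    linarith
  · rw [sum_congr rfl (g := fun _ => weight n #S) fun z h => by
      rw [charge, (hz z h).1, (hz z h).2, if_neg hmid, add_zero], sum_const, nsmul_eq_mul, htot]

lemma sum_weight_div_choose_le (hI : Intersecting F) (hB : ButterflyFree F)
    (hsize : ∀ A ∈ F, 2 ≤ #A ∧ #A ≤ n - 2) :
    ∑ S ∈ F, weight n #S / n.choose #S ≤ 2 := by
  classical
  rcases F.eq_empty_or_nonempty with rfl | ⟨S₀, hS₀⟩
  · simp
  have hn : 0 < n := by have := hsize S₀ hS₀; omega
  have h1 : ∑ z ∈ permArcs n with arcImage z.1 z.2 ∈ F, charge F z.1 z.2 ≤ n ! * (2 * n) := by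
    rw [sum_filter, permArcs, sum_product]
    simp only [← sum_filter]
    refine (sum_le_sum fun σ _ => sum_charge_le hI hB hsize).trans_eq ?_
    rw [sum_const, Finset.card_univ, Fintype.card_perm, Fintype.card_fin, nsmul_eq_mul]
  have h2 : ∑ S ∈ F, (n * ((#S)! * (n - #S)!) : ℕ) * weight n #S ≤ n ! * (2 * n) := by
    refine le_trans ?_ h1
    rw [← sum_fiberwise_of_maps_to (t := F)
      (g := fun z : Equiv.Perm (Fin n) × (Fin n × ℕ) => arcImage z.1 z.2)
      fun z hz => (mem_filter.1 hz).2]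
    refine sum_le_sum fun S hS => (le_sum_charge hB hsize hS).trans_eq (sum_congr ?_ fun _ _ => rfl)
    rw [filter_filter]
    refine filter_congr fun z _ => ⟨fun h => ⟨h ▸ hS, h⟩, And.right⟩
  have hpos : (0 : ℚ) < n ! * n := by positivity
  rw [← mul_le_mul_iff_of_pos_left hpos, mul_sum]
  refine (sum_congr rfl fun S hS => ?_).trans_le (h2.trans_eq (by ring))
  have hle : #S ≤ n := by have := hsize S hS; omega
  have hc : (0 : ℚ) < n.choose #S := by exact_mod_cast Nat.choose_pos hle
  rw [← Nat.choose_mul_factorial_mul_factorial hle]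
  push_cast
  field_simp

lemma one_div_choose_eq {n s : ℕ} (hs : 0 < s) (hsn : 2 * s ≤ n) :
    (1 : ℚ) / n.choose (s - 1) = weight n s / n.choose s := by
  obtain ⟨k, rfl⟩ := Nat.exists_eq_add_of_le' hs
  have h := Nat.choose_succ_right_eq n k
  have h1 : (0 : ℚ) < n.choose k := by exact_mod_cast Nat.choose_pos (by omega)
  have h2 : (0 : ℚ) < n.choose (k + 1) := by exact_mod_cast Nat.choose_pos (by omega)
  have h' : (n.choose (k + 1) * (k + 1) : ℚ) = n.choose k * (n - k) := by
    rw [← Nat.cast_sub (by omega)]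
    exact_mod_cast h
  rw [weight, if_pos hsn, Nat.add_sub_cancel, div_eq_div_iff h1.ne' h2.ne']
  push_cast
  have : (k + 1 : ℚ) ≠ 0 := by positivity
  field_simp
  linarith

end Counting

end CircularArc

theorem gkk_type_inequality (n : ℕ) (F : Finset (Finset (Fin n)))
    (hF : Intersecting F) (hB : ButterflyFree F)
    (hsize : ∀ A ∈ F, 2 ≤ A.card ∧ A.card ≤ n - 2) :
    (∑ A ∈ F.filter (fun A => 2 * A.card ≤ n), (1 : ℚ) / (Nat.choose n (A.card - 1))) +
      (∑ A ∈ F.filter (fun A => n < 2 * A.card), (1 : ℚ) / (Nat.choose n A.card)) ≤ 2 := by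
  refine le_of_eq_of_le ?_ (CircularArc.sum_weight_div_choose_le hF hB hsize)
  rw [← Finset.sum_filter_add_sum_filter_not F fun A => 2 * A.card ≤ n]
  simp only [not_le]
  congr 1
  · refine Finset.sum_congr rfl fun A hA => ?_
    obtain ⟨hA, hn⟩ := Finset.mem_filter.1 hA
    exact CircularArc.one_div_choose_eq (by have := hsize A hA; omega) hn
  · refine Finset.sum_congr rfl fun A hA => ?_
    obtain ⟨-, hn⟩ := Finset.mem_filter.1 hA
    rw [CircularArc.weight, if_neg (by omega)]
end

section
/- Let F be an intersecting butterfly-free family of subsets of [n] such that 2 ≤ |F| ≤ n/2 for all F ∈ F. Then Σ_{F ∈ F} 1/C(n−1, |F|−1) ≤ 2. -/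
open Finset

/-- The cyclic interval of `Fin n` with `p.2` elements that starts at `p.1`. -/
def cyclicArc {n : ℕ} (p : Fin n × ℕ) : Finset (Fin n) :=
  univ.filter fun x => (p.1.val ≤ x.val ∧ x.val < p.1.val + p.2) ∨ x.val + n < p.1.val + p.2

theorem mem_cyclicArc {n : ℕ} {p : Fin n × ℕ} {x : Fin n} :
    x ∈ cyclicArc p ↔
      (p.1.val ≤ x.val ∧ x.val < p.1.val + p.2) ∨ x.val + n < p.1.val + p.2 := by
  simp [cyclicArc]

theorem card_cyclicArc {n : ℕ} (p : Fin n × ℕ) (hp : p.2 ≤ n) : (cyclicArc p).card = p.2 := by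
  conv_rhs => rw [← card_range p.2]
  symm
  have ht := p.1.isLt
  refine card_bij (fun j hj => ⟨if p.1.val + j < n then p.1.val + j else p.1.val + j - n, ?_⟩)
    ?_ ?_ ?_
  · have := mem_range.1 hj
    split_ifs <;> omega
  · intro j hj
    have := mem_range.1 hj
    rw [mem_cyclicArc]
    dsimp only
    split_ifs <;> omega
  · intro i hi j hj h
    have := mem_range.1 hi
    have := mem_range.1 hj
    simp only [Fin.mk.injEq] at h
    split_ifs at h <;> omega
  · intro x hx
    have hxn := x.isLt
    rw [mem_cyclicArc] at hx
    by_cases h : p.1.val ≤ x.val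
    · refine ⟨x.val - p.1.val, mem_range.2 (by omega), Fin.ext ?_⟩
      dsimp only
      split_ifs <;> omega
    · refine ⟨x.val + n - p.1.val, mem_range.2 (by omega), Fin.ext ?_⟩
      dsimp only
      split_ifs <;> omega

theorem cyclicArc_injOn {n : ℕ} {p q : Fin n × ℕ} (hp : 0 < p.2) (hpn : 2 * p.2 ≤ n)
    (hqn : 2 * q.2 ≤ n) (h : cyclicArc p = cyclicArc q) : p = q := by
  have hc : p.2 = q.2 := by
    rw [← card_cyclicArc p (by omega), h, card_cyclicArc q (by omega)]
  have h₁ : p.1 ∈ cyclicArc q := h ▸ mem_cyclicArc.2 (by omega)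
  have h₂ : q.1 ∈ cyclicArc p := h ▸ mem_cyclicArc.2 (by omega)
  rw [mem_cyclicArc] at h₁ h₂
  exact Prod.ext (Fin.ext (by omega)) hc

theorem cyclicArc_subset_of_val {n : ℕ} {p q : Fin n × ℕ}
    (h : (q.1.val ≤ p.1.val ∧ p.1.val + p.2 ≤ q.1.val + q.2) ∨
      p.1.val + n + p.2 ≤ q.1.val + q.2) (hq : q.2 ≤ n) : cyclicArc p ⊆ cyclicArc q := by
  intro x hx
  have := x.isLt
  rw [mem_cyclicArc] at hx ⊢
  omega

/-- Intersecting antichains of arcs of length at most `n / 2` satisfy Katona's bound. -/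
theorem sum_inv_length_le_one {n : ℕ} (G : Finset (Fin n × ℕ))
    (hsize : ∀ p ∈ G, 0 < p.2 ∧ 2 * p.2 ≤ n)
    (hint : ∀ p ∈ G, ∀ q ∈ G, (cyclicArc p ∩ cyclicArc q).Nonempty)
    (hanti : ∀ p ∈ G, ∀ q ∈ G, ¬ cyclicArc p ⊂ cyclicArc q) :
    ∑ p ∈ G, (1 : ℚ) / p.2 ≤ 1 := by
  rcases G.eq_empty_or_nonempty with rfl | hne
  · simp
  obtain ⟨m, hm, hmin⟩ := exists_min_image G (fun p => p.2) hne
  obtain ⟨hm0, hmn⟩ := hsize m hm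
  have hsub : ∀ p ∈ G, ∀ q ∈ G, cyclicArc p ⊆ cyclicArc q → p = q := by
    intro p hp q hq h
    by_contra hne
    refine hanti p hp q hq (h.ssubset_of_ne fun h' => hne ?_)
    exact cyclicArc_injOn (hsize p hp).1 (hsize p hp).2 (hsize q hq).2 h'
  let fin : Fin n × ℕ → Fin n := fun p =>
    if h : p.1.val + p.2 < n then ⟨p.1.val + p.2, h⟩
    else ⟨(p.1.val + p.2 - n) % n, Nat.mod_lt _ (Nat.zero_lt_of_lt p.1.isLt)⟩
  have hfin : ∀ p ∈ G, (fin p).val = p.1.val + p.2 ∨ (fin p).val + n = p.1.val + p.2 := by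
    intro p hp
    have := hsize p hp
    have := p.1.isLt
    by_cases h : p.1.val + p.2 < n
    · simp [fin, h]
    · right
      simp only [fin, h, dite_false]
      rw [Nat.mod_eq_of_lt (by omega)]
      omega
  let f : Fin n × ℕ → Fin n := fun p =>
    if p = m then m.1 else if p.1 ∈ cyclicArc m ∧ p.1 ≠ m.1 then p.1 else fin p
  have hdich : ∀ p ∈ G, p ≠ m → (p.1 ∈ cyclicArc m ∧ p.1 ≠ m.1) ∨
      (fin p ∈ cyclicArc m ∧ fin p ≠ m.1) := by
    intro p hp hpm
    have h1 := hsize p hp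
    have h2 := hmin p hp
    have h3 := hfin p hp
    have h4 := p.1.isLt
    have h5 := m.1.isLt
    obtain ⟨x, hx⟩ := hint p hp m hm
    have h6 := x.isLt
    have h7 := (fin p).isLt
    have h8 : ¬ cyclicArc m ⊆ cyclicArc p := fun h => hpm (hsub m hm p hp h).symm
    have h9 := mt (fun h => cyclicArc_subset_of_val (p := m) (q := p) h (by omega)) h8
    rw [mem_inter, mem_cyclicArc, mem_cyclicArc] at hx
    rw [mem_cyclicArc, mem_cyclicArc, Ne, Ne, Fin.ext_iff, Fin.ext_iff]
    omega
  have hsame : ∀ p ∈ G, ∀ q ∈ G, p.1 = q.1 → p = q := by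
    intro p hp q hq h
    have h1 := hsize p hp
    have h2 := hsize q hq
    rcases le_total p.2 q.2 with h' | h'
    · exact hsub p hp q hq (cyclicArc_subset_of_val (by omega) (by omega))
    · exact (hsub q hq p hp (cyclicArc_subset_of_val (by omega) (by omega))).symm
  have hsame' : ∀ p ∈ G, ∀ q ∈ G, fin p = fin q → p = q := by
    intro p hp q hq h
    have h1 := hsize p hp
    have h2 := hsize q hq
    have h3 := hfin p hp
    have h4 := hfin q hq
    have h5 := p.1.isLt
    have h6 := q.1.isLt
    rw [Fin.ext_iff] at h
    rcases le_total p.2 q.2 with h' | h'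
    · exact hsub p hp q hq (cyclicArc_subset_of_val (by omega) (by omega))
    · exact (hsub q hq p hp (cyclicArc_subset_of_val (by omega) (by omega))).symm
  have hcross : ∀ p ∈ G, ∀ q ∈ G, p.1 ≠ fin q := by
    intro p hp q hq h
    have h1 := hsize p hp
    have h2 := hsize q hq
    have h3 := hfin q hq
    obtain ⟨x, hx⟩ := hint p hp q hq
    have h4 := x.isLt
    have h5 := p.1.isLt
    have h6 := q.1.isLt
    rw [mem_inter, mem_cyclicArc, mem_cyclicArc] at hx
    rw [Fin.ext_iff] at h
    omega
  have hcard : G.card ≤ m.2 := by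
    rw [← card_cyclicArc m (by omega)]
    refine card_le_card_of_injOn f ?_ ?_
    · intro p hp
      by_cases hpm : p = m
      · have : m.1 ∈ cyclicArc m := mem_cyclicArc.2 (by omega)
        simpa [f, hpm] using this
      · have := hdich p hp hpm
        simp only [f, if_neg hpm]
        split_ifs with h
        · exact h.1
        · exact (this.resolve_left h).1
    · intro p hp q hq h
      have hp' := hdich p hp
      have hq' := hdich q hq
      have e1 := hsame p hp q hq
      have e2 := hsame' p hp q hq
      have e3 := hcross p hp q hq
      have e4 := hcross q hq p hp
      simp only [f] at h
      split_ifs at h <;> grind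
  have hm0' : (0 : ℚ) < m.2 := by exact_mod_cast hm0
  calc ∑ p ∈ G, (1 : ℚ) / p.2 ≤ ∑ p ∈ G, (1 : ℚ) / m.2 :=
        sum_le_sum fun p hp => one_div_le_one_div_of_le hm0' (by exact_mod_cast hmin p hp)
    _ = G.card / m.2 := by rw [sum_const, nsmul_eq_mul]; ring
    _ ≤ 1 := by
        rw [div_le_one hm0']
        exact_mod_cast hcard

theorem exists_perm_map_eq_of_subset {α : Type*} [Fintype α] [DecidableEq α]
    {S A A' : Finset α} (hA : A ⊆ S) (hA' : A' ⊆ S) (hc : A.card = A'.card) :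
    ∃ h : Equiv.Perm α, A.map h.toEmbedding = A' ∧ ∀ x ∉ S, h x = x := by
  have e : {x : S // x.1 ∈ A} ≃ {x : S // x.1 ∈ A'} := by
    refine Fintype.equivOfCardEq ?_
    rw [Fintype.card_subtype, Fintype.card_subtype]
    have key : ∀ T ⊆ S, (univ.filter fun x : S => x.1 ∈ T).card = T.card := by
      intro T hT
      rw [← card_map (Function.Embedding.subtype _)]
      congr 1
      ext x
      simp only [mem_map, mem_filter, mem_univ, true_and, Function.Embedding.subtype_apply,
        Subtype.exists, exists_and_left, exists_prop, exists_eq_right_right]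
      exact ⟨fun h => h.1, fun h => ⟨h, hT h⟩⟩
    rw [key A hA, key A' hA', hc]
  refine ⟨Equiv.Perm.ofSubtype e.extendSubtype, ?_, ?_⟩
  · refine eq_of_subset_of_card_le ?_ (by rw [card_map, hc])
    intro y hy
    obtain ⟨x, hx, rfl⟩ := mem_map.1 hy
    have := e.extendSubtype_mem ⟨x, hA hx⟩ hx
    rw [Equiv.coe_toEmbedding, Equiv.Perm.ofSubtype_apply_of_mem _ (hA hx)]
    exact this
  · intro x hx
    exact Equiv.Perm.ofSubtype_apply_of_not_mem _ hx

theorem map_eq_self_of_forall_fixed {α : Type*} {S : Finset α} {h : Equiv.Perm α}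
    (hS : ∀ x ∈ S, h x = x) : S.map h.toEmbedding = S := by
  ext y
  simp only [mem_map, Equiv.coe_toEmbedding]
  constructor
  · rintro ⟨x, hx, rfl⟩
    rwa [hS x hx]
  · exact fun hy => ⟨y, hy, hS y hy⟩

/-- Given that a permutation maps `Y` to `B`, the images of a subset `X` of `Y` and of a superset
`Z` of `Y` are independent and uniformly distributed. -/
theorem card_perm_flag {α : Type*} [Fintype α] [DecidableEq α] {X Y Z A B C : Finset α}
    (hXY : X ⊆ Y) (hYZ : Y ⊆ Z) (hAB : A ⊆ B) (hBC : B ⊆ C)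
    (hA : X.card = A.card) (hC : Z.card = C.card) :
    (univ.filter fun g : Equiv.Perm α => X.map g.toEmbedding = A ∧ Y.map g.toEmbedding = B ∧
        Z.map g.toEmbedding = C).card *
      (B.card.choose A.card * (Fintype.card α - B.card).choose (C.card - B.card)) =
    (univ.filter fun g : Equiv.Perm α => Y.map g.toEmbedding = B).card := by
  symm
  rw [card_eq_sum_card_fiberwise
    (f := fun g : Equiv.Perm α => (X.map g.toEmbedding, Z.map g.toEmbedding \ B))
    (t := powersetCard A.card B ×ˢ powersetCard (C.card - B.card) Bᶜ)]
  · rw [sum_const_nat (m := (univ.filter fun g : Equiv.Perm α => X.map g.toEmbedding = A ∧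
      Y.map g.toEmbedding = B ∧ Z.map g.toEmbedding = C).card)]
    · rw [card_product, card_powersetCard, card_powersetCard, card_compl,
        mul_comm]
    · rintro ⟨A', D⟩ hAD
      rw [mem_product, mem_powersetCard, mem_powersetCard] at hAD
      obtain ⟨⟨hA'B, hA'⟩, hDB, hD⟩ := hAD
      dsimp only at hA'B hA' hDB hD
      obtain ⟨h₁, h₁A, h₁f⟩ := exists_perm_map_eq_of_subset hAB hA'B hA'.symm
      obtain ⟨h₂, h₂C, h₂f⟩ := exists_perm_map_eq_of_subset (S := Bᶜ) (A := C \ B) (A' := D)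
        (fun x hx => by simp at hx ⊢; exact hx.2) hDB (by rw [hD, card_sdiff_of_subset hBC])
      have h₁B : B.map h₁.toEmbedding = B := by
        refine eq_of_subset_of_card_le ?_ (by rw [card_map])
        intro y hy
        obtain ⟨x, hx, rfl⟩ := mem_map.1 hy
        by_contra hy
        have := h₁.injective (h₁f _ hy)
        simp only [Equiv.coe_toEmbedding] at hy this
        rw [this] at hy
        exact hy hx
      have h₂B : ∀ T ⊆ B, T.map h₂.toEmbedding = T := fun T hT =>
        map_eq_self_of_forall_fixed fun x hx => h₂f x (by simpa using hT hx)
      have h₁C : (C \ B).map h₁.toEmbedding = C \ B :=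
        map_eq_self_of_forall_fixed fun x hx => h₁f x (mem_sdiff.1 hx).2
      have hmul : ∀ (T : Finset α) (g h : Equiv.Perm α),
          T.map (h * g).toEmbedding = (T.map g.toEmbedding).map h.toEmbedding := by
        intro T g h
        rw [map_map]
        rfl
      have hhA : A.map (h₂ * h₁).toEmbedding = A' := by rw [hmul, h₁A, h₂B _ hA'B]
      have hhB : B.map (h₂ * h₁).toEmbedding = B := by rw [hmul, h₁B, h₂B _ subset_rfl]
      have hhC : C.map (h₂ * h₁).toEmbedding = B ∪ D := by
        rw [← union_sdiff_of_subset hBC, map_union, hhB, hmul, h₁C, h₂C]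
      have hDdisj : Disjoint B D := by
        rw [disjoint_left]
        intro x hx hx'
        exact (mem_compl.1 (hDB hx')) hx
      symm
      refine card_bij (fun g _ => (h₂ * h₁) * g) ?_ ?_ ?_
      · intro g hg
        simp only [mem_filter, mem_univ, true_and] at hg
        obtain ⟨h1, h2, h3⟩ := hg
        simp only [mem_filter, mem_univ, true_and, Prod.mk.injEq]
        rw [hmul Y g, h2, hmul X g, h1, hmul Z g, h3]
        refine ⟨hhB, hhA, ?_⟩
        rw [hhC, union_sdiff_left, sdiff_eq_self_of_disjoint hDdisj.symm]
      · intro g _ g' _ h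
        exact mul_left_cancel h
      · intro g hg
        simp only [mem_filter, mem_univ, true_and, Prod.mk.injEq] at hg
        obtain ⟨h2, h1, h3⟩ := hg
        have hZ : Z.map g.toEmbedding = B ∪ D := by
          rw [← h3, union_sdiff_of_subset]
          rw [← h2]
          exact map_subset_map.2 hYZ
        have cancel : ∀ {S T : Finset α}, S.map (h₂ * h₁).toEmbedding = T →
            ∀ U : Finset α, U.map g.toEmbedding = T →
              U.map ((h₂ * h₁)⁻¹ * g).toEmbedding = S := by
          intro S T hST U hU
          apply map_injective (h₂ * h₁).toEmbedding
          rw [hST, ← hmul, mul_inv_cancel_left, hU]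
        refine ⟨(h₂ * h₁)⁻¹ * g, ?_, by rw [mul_inv_cancel_left]⟩
        simp only [mem_filter, mem_univ, true_and]
        exact ⟨cancel hhA X h1, cancel hhB Y h2, cancel hhC Z hZ⟩
  · intro g hg
    have hg := (mem_filter.1 hg).2
    rw [mem_coe, mem_product, mem_powersetCard, mem_powersetCard]
    refine ⟨⟨?_, by rw [card_map, hA]⟩, ?_, ?_⟩
    · rw [← hg]
      exact map_subset_map.2 hXY
    · exact fun x hx => mem_compl.2 (mem_sdiff.1 hx).2
    · rw [card_sdiff_of_subset, card_map, hC]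
      rw [← hg]
      exact map_subset_map.2 hYZ

theorem card_perm_map_eq_mul_choose {α : Type*} [Fintype α] [DecidableEq α] {X A : Finset α}
    (h : X.card = A.card) :
    (univ.filter fun g : Equiv.Perm α => X.map g.toEmbedding = A).card *
      (Fintype.card α).choose A.card = (Fintype.card α).factorial := by
  have := card_perm_flag (subset_univ X) (subset_univ (univ : Finset α)) (subset_univ A)
    (subset_univ (univ : Finset α)) h rfl
  simpa [map_univ_equiv, Fintype.card_perm] using this

theorem card_perm_lower_mul_choose {α : Type*} [Fintype α] [DecidableEq α]
    {X Y A B : Finset α} (hXY : X ⊆ Y) (hAB : A ⊆ B)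
    (hA : X.card = A.card) (hB : Y.card = B.card) :
    (univ.filter fun g : Equiv.Perm α => X.map g.toEmbedding = A ∧
        Y.map g.toEmbedding = B).card * B.card.choose A.card =
    (univ.filter fun g : Equiv.Perm α => Y.map g.toEmbedding = B).card := by
  have := card_perm_flag hXY subset_rfl hAB subset_rfl hA hB
  simpa using this

theorem card_perm_upper_mul_choose {α : Type*} [Fintype α] [DecidableEq α]
    {Y Z B C : Finset α} (hYZ : Y ⊆ Z) (hBC : B ⊆ C)
    (hB : Y.card = B.card) (hC : Z.card = C.card) :
    (univ.filter fun g : Equiv.Perm α => Y.map g.toEmbedding = B ∧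
        Z.map g.toEmbedding = C).card * (Fintype.card α - B.card).choose (C.card - B.card) =
    (univ.filter fun g : Equiv.Perm α => Y.map g.toEmbedding = B).card := by
  have := card_perm_flag subset_rfl hYZ subset_rfl hBC hB hC
  simpa using this

theorem three_mul_le_two_mul_choose {a b : ℕ} (ha : 2 ≤ a) (hab : a < b) :
    3 * (b - a + 1) ≤ 2 * b.choose a := by
  obtain ⟨k, rfl⟩ := Nat.exists_eq_add_of_lt hab
  obtain ⟨i, rfl⟩ := Nat.exists_eq_add_of_le ha
  have h1 : (k + 3).choose (k + 1) ≤ (2 + i + k + 1).choose (k + 1) :=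
    Nat.choose_le_choose _ (by omega)
  have h2 : (2 + i + k + 1).choose (2 + i) = (2 + i + k + 1).choose (k + 1) :=
    Nat.choose_symm_of_eq_add (by omega)
  have h3 : (k + 3).choose (k + 1) = (k + 3).choose 2 :=
    Nat.choose_symm_of_eq_add (by omega)
  have h4 : 2 * (k + 3).choose 2 = (k + 3) * (k + 2) := by
    have := Nat.add_one_mul_choose_eq (k + 2) 1
    rw [Nat.choose_one_right] at this
    linarith
  rw [h2]
  have : 2 + i + k + 1 - (2 + i) + 1 = k + 2 := by omega
  rw [this]
  nlinarith

theorem three_mul_le_choose_add_five (j : ℕ) : 3 * (j + 2) ≤ (j + 6).choose 5 := by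
  induction j with
  | zero => decide
  | succ j ih =>
    have h1 : (j + 7).choose 5 = (j + 6).choose 4 + (j + 6).choose 5 :=
      Nat.choose_succ_succ _ _
    have h2 : (6).choose 4 ≤ (j + 6).choose 4 := Nat.choose_le_choose _ (by omega)
    have h3 : (6).choose 4 = 15 := by decide
    have h4 : j + 1 + 6 = j + 7 := by omega
    rw [h4]
    omega

theorem three_mul_le_choose {m j : ℕ} (hj : 1 ≤ j) (hm : j + 5 ≤ m) :
    3 * (j + 1) ≤ m.choose j := by
  obtain ⟨i, rfl⟩ := Nat.exists_eq_add_of_le' hj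
  have h1 : (i + 6).choose (i + 1) ≤ m.choose (i + 1) := Nat.choose_le_choose _ (by omega)
  have h2 : (i + 6).choose (i + 1) = (i + 6).choose 5 := Nat.choose_symm_of_eq_add (by omega)
  have := three_mul_le_choose_add_five i
  omega

/-- Twelve times the contribution of an arc of length `12 / k` to the eight-point inequality, where
`y`, `u`, `v` tell whether the arc is present, contains a present arc, is contained in one. -/
def arcWeight (y u v : Bool) (k : ℕ) : ℕ :=
  if y then (if u then 0 else k) + (if v then 0 else k) + (if u && v then 1 else 0) else 0

/-- The total of `arcWeight` over the twelve arcs on eight points that meet a fixed arc of length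
two, the latter being present. -/
def eightWeight (a b c₆ c₇ c₀ c₁ d₅ d₆ d₇ d₀ d₁ : Bool) : ℕ :=
  arcWeight true false (c₀ || c₇ || d₀ || d₇ || d₆) 6 +
    arcWeight b false (c₁ || c₀ || d₁ || d₀ || d₇) 6 +
    arcWeight a false (c₇ || c₆ || d₇ || d₆ || d₅) 6 +
    arcWeight c₀ (true || b) (d₀ || d₇) 4 + arcWeight c₁ b (d₁ || d₀) 4 +
    arcWeight c₆ a (d₆ || d₅) 4 + arcWeight c₇ (a || true) (d₇ || d₆) 4 +
    arcWeight d₀ (true || b || c₀ || c₁) false 3 + arcWeight d₁ (b || c₁) false 3 +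
    arcWeight d₅ (a || c₆) false 3 + arcWeight d₆ (a || true || c₆ || c₇) false 3 +
    arcWeight d₇ (a || true || b || c₇ || c₀) false 3

theorem eightWeight_le (a b c₆ c₇ c₀ c₁ d₅ d₆ d₇ d₀ d₁ : Bool)
    (h₁ : (a && b) = false) (h₂ : (c₆ && b) = false) (h₃ : (c₁ && a) = false)
    (h₄ : (c₁ && c₆) = false) (h₅ : (d₅ && b) = false) (h₆ : (d₅ && c₁) = false)
    (h₇ : (d₁ && a) = false) (h₈ : (d₁ && c₆) = false) (h₉ : (d₁ && d₅) = false)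
    (h₁₀ : (a && d₆ && d₇) = false) (h₁₁ : (b && d₇ && d₀) = false) :
    eightWeight a b c₆ c₇ c₀ c₁ d₅ d₆ d₇ d₀ d₁ ≤ 24 := by
  revert a b c₆ c₇ c₀ c₁ d₅ d₆ d₇ d₀ d₁
  decide +kernel

/-- The indicator of `p` containing another arc of `G` strictly. -/
def lowerInd {n : ℕ} (G : Finset (Fin n × ℕ)) (p : Fin n × ℕ) : ℚ :=
  if ∃ q ∈ G, cyclicArc q ⊂ cyclicArc p then 1 else 0

/-- The indicator of `p` being strictly contained in another arc of `G`. -/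
def upperInd {n : ℕ} (G : Finset (Fin n × ℕ)) (p : Fin n × ℕ) : ℚ :=
  if ∃ q ∈ G, cyclicArc p ⊂ cyclicArc q then 1 else 0

theorem sum_minimal_le_one {n : ℕ} (G : Finset (Fin n × ℕ))
    (hsize : ∀ p ∈ G, 2 ≤ p.2 ∧ 2 * p.2 ≤ n)
    (hint : ∀ p ∈ G, ∀ q ∈ G, (cyclicArc p ∩ cyclicArc q).Nonempty) :
    ∑ p ∈ G, (1 : ℚ) / p.2 * (1 - lowerInd G p) ≤ 1 := by
  have := sum_inv_length_le_one (G.filter fun p => ¬ ∃ q ∈ G, cyclicArc q ⊂ cyclicArc p)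
    (fun p hp => ⟨by linarith [(hsize p (mem_filter.1 hp).1).1], (hsize p (mem_filter.1 hp).1).2⟩)
    (fun p hp q hq => hint p (mem_filter.1 hp).1 q (mem_filter.1 hq).1)
    (fun p hp q hq h => (mem_filter.1 hq).2 ⟨p, (mem_filter.1 hp).1, h⟩)
  rw [sum_filter] at this
  refine le_trans (le_of_eq (sum_congr rfl fun p _ => ?_)) this
  unfold lowerInd
  split_ifs <;> simp_all

theorem sum_maximal_le_one {n : ℕ} (G : Finset (Fin n × ℕ))
    (hsize : ∀ p ∈ G, 2 ≤ p.2 ∧ 2 * p.2 ≤ n)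
    (hint : ∀ p ∈ G, ∀ q ∈ G, (cyclicArc p ∩ cyclicArc q).Nonempty) :
    ∑ p ∈ G, (1 : ℚ) / p.2 * (1 - upperInd G p) ≤ 1 := by
  have := sum_inv_length_le_one (G.filter fun p => ¬ ∃ q ∈ G, cyclicArc p ⊂ cyclicArc q)
    (fun p hp => ⟨by linarith [(hsize p (mem_filter.1 hp).1).1], (hsize p (mem_filter.1 hp).1).2⟩)
    (fun p hp q hq => hint p (mem_filter.1 hp).1 q (mem_filter.1 hq).1)
    (fun p hp q hq h => (mem_filter.1 hp).2 ⟨q, (mem_filter.1 hq).1, h⟩)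
  rw [sum_filter] at this
  refine le_trans (le_of_eq (sum_congr rfl fun p _ => ?_)) this
  unfold upperInd
  split_ifs <;> simp_all

theorem sum_minimal_add_maximal_le {n : ℕ} (G : Finset (Fin n × ℕ))
    (hsize : ∀ p ∈ G, 2 ≤ p.2 ∧ 2 * p.2 ≤ n)
    (hint : ∀ p ∈ G, ∀ q ∈ G, (cyclicArc p ∩ cyclicArc q).Nonempty) :
    ∑ p ∈ G, (1 : ℚ) / p.2 * (2 - lowerInd G p - upperInd G p) ≤ 2 := by
  have h1 := sum_minimal_le_one G hsize hint
  have h2 := sum_maximal_le_one G hsize hint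
  calc _ = ∑ p ∈ G, (1 : ℚ) / p.2 * (1 - lowerInd G p) +
        ∑ p ∈ G, (1 : ℚ) / p.2 * (1 - upperInd G p) := by
          rw [← sum_add_distrib]
          exact sum_congr rfl fun p _ => by ring
    _ ≤ 2 := by linarith

theorem cyclicArc_ssubset_iff_eight : ∀ x y : Fin 8, ∀ k ∈ Icc 2 4, ∀ l ∈ Icc 2 4,
    (cyclicArc (x, k) ⊂ cyclicArc (y, l) ↔
      k = 2 ∧ l = 3 ∧ (x = y ∨ x = y + 1) ∨ k = 3 ∧ l = 4 ∧ (x = y ∨ x = y + 1) ∨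
      k = 2 ∧ l = 4 ∧ (x = y ∨ x = y + 1 ∨ x = y + 2)) := by
  decide +kernel

theorem cyclicArc_disjoint_eight : ∀ x y : Fin 8, ∀ k ∈ Icc 2 4, ∀ l ∈ Icc 2 4,
    (∃ i ∈ Icc k (8 - l), y.val = (x.val + i) % 8) →
      ¬ (cyclicArc (x, k) ∩ cyclicArc (y, l)).Nonempty := by
  decide +kernel

theorem exists_cyclicArc_ssubset_iff_eight {G : Finset (Fin 8 × ℕ)}
    (hlen : ∀ p ∈ G, p.2 ∈ Icc 2 4) {x : Fin 8} {l : ℕ} (hx : (x, l) ∈ G) :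
    (∃ q ∈ G, cyclicArc q ⊂ cyclicArc (x, l)) ↔
      l = 3 ∧ ((x, 2) ∈ G ∨ (x + 1, 2) ∈ G) ∨
      l = 4 ∧ ((x, 2) ∈ G ∨ (x + 1, 2) ∈ G ∨ (x + 2, 2) ∈ G ∨ (x, 3) ∈ G ∨
        (x + 1, 3) ∈ G) := by
  have hss : ∀ z k, (z, k) ∈ G → _ := fun z k hz =>
    cyclicArc_ssubset_iff_eight z x k (hlen _ hz) l (hlen _ hx)
  constructor
  · rintro ⟨⟨z, k⟩, hq, h⟩
    obtain ⟨rfl, rfl, rfl | rfl⟩ | ⟨rfl, rfl, rfl | rfl⟩ | ⟨rfl, rfl, rfl | rfl | rfl⟩ :=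
      (hss z k hq).1 h <;> simp [hq]
  · rintro (⟨rfl, h | h⟩ | ⟨rfl, h | h | h | h | h⟩) <;>
      exact ⟨_, h, (hss _ _ h).2 (by simp)⟩

theorem exists_ssubset_cyclicArc_iff_eight {G : Finset (Fin 8 × ℕ)}
    (hlen : ∀ p ∈ G, p.2 ∈ Icc 2 4) {x : Fin 8} {l : ℕ} (hx : (x, l) ∈ G) :
    (∃ q ∈ G, cyclicArc (x, l) ⊂ cyclicArc q) ↔
      l = 2 ∧ ((x, 3) ∈ G ∨ (x - 1, 3) ∈ G ∨ (x, 4) ∈ G ∨ (x - 1, 4) ∈ G ∨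
        (x - 2, 4) ∈ G) ∨
      l = 3 ∧ ((x, 4) ∈ G ∨ (x - 1, 4) ∈ G) := by
  have hss : ∀ z k, (z, k) ∈ G → _ := fun z k hz =>
    cyclicArc_ssubset_iff_eight x z l (hlen _ hx) k (hlen _ hz)
  constructor
  · rintro ⟨⟨z, k⟩, hq, h⟩
    obtain ⟨rfl, rfl, rfl | rfl⟩ | ⟨rfl, rfl, rfl | rfl⟩ | ⟨rfl, rfl, rfl | rfl | rfl⟩ :=
      (hss z k hq).1 h <;> simp [hq]
  · rintro (⟨rfl, h | h | h | h | h⟩ | ⟨rfl, h | h⟩) <;>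
      exact ⟨_, h, (hss _ _ h).2 (by simp)⟩

theorem sum_eq_sum_translate_eight {G : Finset (Fin 8 × ℕ)}
    (hlen : ∀ p ∈ G, p.2 ∈ Icc 2 4) (t : Fin 8) (φ : Fin 8 × ℕ → ℚ) :
    ∑ p ∈ G, φ p = ∑ i, (if (t + i, 2) ∈ G then φ (t + i, 2) else 0) +
      ∑ i, (if (t + i, 3) ∈ G then φ (t + i, 3) else 0) +
      ∑ i, (if (t + i, 4) ∈ G then φ (t + i, 4) else 0) := by
  have hG : G = (univ ×ˢ Icc 2 4).filter (· ∈ G) := by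
    ext p
    simp only [mem_filter, mem_product, mem_univ, true_and]
    exact ⟨fun h => ⟨hlen p h, h⟩, fun h => h.2⟩
  have hshift : ∀ l : ℕ, ∑ i, (if (t + i, l) ∈ G then φ (t + i, l) else 0) =
      ∑ i, (if (i, l) ∈ G then φ (i, l) else 0) := fun l =>
    Equiv.sum_comp (Equiv.addLeft t) fun i => if (i, l) ∈ G then φ (i, l) else 0
  rw [hshift, hshift, hshift]
  calc _ = ∑ p ∈ (univ ×ˢ Icc 2 4).filter (· ∈ G), φ p := by rw [← hG]
    _ = _ := by
      rw [sum_filter, sum_product_right, show Icc 2 4 = ({2, 3, 4} : Finset ℕ) from rfl,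
        sum_insert (by decide), sum_pair (by decide), ← add_assoc]

theorem sum_minimal_add_maximal_le_eight (G : Finset (Fin 8 × ℕ))
    (hsize : ∀ p ∈ G, 2 ≤ p.2 ∧ 2 * p.2 ≤ 8)
    (hint : ∀ p ∈ G, ∀ q ∈ G, (cyclicArc p ∩ cyclicArc q).Nonempty)
    (hbf : ∀ p ∈ G, ∀ q ∈ G, ∀ r ∈ G, ∀ s ∈ G, p ≠ q → r ≠ s →
      cyclicArc p ⊂ cyclicArc r → cyclicArc p ⊂ cyclicArc s →
      cyclicArc q ⊂ cyclicArc r → cyclicArc q ⊂ cyclicArc s → False) :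
    ∑ p ∈ G, (1 : ℚ) / p.2 *
      (2 - lowerInd G p - upperInd G p + 1 / 4 * (lowerInd G p * upperInd G p)) ≤ 2 := by
  by_cases hmid : ∀ p ∈ G, lowerInd G p * upperInd G p = 0
  · refine le_trans (le_of_eq (sum_congr rfl fun p hp => ?_))
      (sum_minimal_add_maximal_le G hsize hint)
    rw [hmid p hp]
    ring
  have hlen : ∀ p ∈ G, p.2 ∈ Icc 2 4 := fun p hp => by
    have := hsize p hp
    rw [mem_Icc]
    omega
  have hss : ∀ p ∈ G, ∀ q ∈ G, _ := fun p hp q hq =>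
    cyclicArc_ssubset_iff_eight p.1 q.1 p.2 (hlen p hp) q.2 (hlen q hq)
  obtain ⟨t, ht⟩ : ∃ t : Fin 8, (t, 2) ∈ G := by
    push Not at hmid
    obtain ⟨p, hp, hne⟩ := hmid
    have hl := left_ne_zero_of_mul hne
    have hu := right_ne_zero_of_mul hne
    simp only [lowerInd, upperInd, ne_eq, ite_eq_right_iff, one_ne_zero, imp_false,
      not_not] at hl hu
    obtain ⟨q, hq, hqp⟩ := hl
    obtain ⟨r, hr, hpr⟩ := hu
    have h1 := (hss q hq p hp).1 hqp
    have h2 := (hss p hp r hr).1 hpr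
    refine ⟨q.1, ?_⟩
    have : q.2 = 2 := by omega
    rwa [← this]
  let y : ℕ → Fin 8 → Bool := fun l i => decide ((t + i, l) ∈ G)
  have hy : ∀ l i, y l i = true ↔ (t + i, l) ∈ G := fun l i => decide_eq_true_iff
  have hy2 : y 2 0 = true := by rw [hy, add_zero]; exact ht
  have hdis : ∀ k ∈ Icc 2 4, ∀ l ∈ Icc 2 4, ∀ i j : Fin 8,
      (∃ m ∈ Icc k (8 - l), j.val = (i.val + m) % 8) → (y l j && y k i) = false := by
    intro k hk l hl i j h
    rw [Bool.eq_false_iff, ne_eq, Bool.and_eq_true, hy, hy]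
    rintro ⟨h1, h2⟩
    refine cyclicArc_disjoint_eight (t + i) (t + j) k hk l hl ?_ (hint _ h2 _ h1)
    obtain ⟨m, hm, hj⟩ := h
    refine ⟨m, hm, ?_⟩
    rw [Fin.val_add, Fin.val_add, hj]
    omega
  have hbut : ∀ i, (y 2 i && y 2 (i + 1) && y 4 (i - 1) && y 4 i) = false := by
    intro i
    rw [Bool.eq_false_iff, ne_eq, Bool.and_eq_true, Bool.and_eq_true, Bool.and_eq_true, hy, hy,
      hy, hy]
    rintro ⟨⟨⟨h1, h2⟩, h3⟩, h4⟩
    have key : ∀ x y z : Fin 8, (x, 2) ∈ G → (z, 4) ∈ G → (x = z ∨ x = z + 1 ∨ x = z + 2) →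
        cyclicArc (x, 2) ⊂ cyclicArc (z, 4) := fun x y z hx hz h =>
      (hss _ hx _ hz).2 (Or.inr (Or.inr ⟨rfl, rfl, h⟩))
    refine hbf _ h1 _ h2 _ h3 _ h4 ?_ ?_ (key _ t _ h1 h3 ?_) (key _ t _ h1 h4 ?_) (key _ t _ h2 h3 ?_)
      (key _ t _ h2 h4 ?_)
    all_goals clear * -; revert t i; decide
  let W : ℕ → Fin 8 → ℚ := fun l i => if (t + i, l) ∈ G then (1 : ℚ) / l *
    (2 - lowerInd G (t + i, l) - upperInd G (t + i, l) +
      1 / 4 * (lowerInd G (t + i, l) * upperInd G (t + i, l))) else 0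
  have hsum : ∑ p ∈ G, (1 : ℚ) / p.2 *
      (2 - lowerInd G p - upperInd G p + 1 / 4 * (lowerInd G p * upperInd G p)) =
      ∑ i, W 2 i + ∑ i, W 3 i + ∑ i, W 4 i :=
    sum_eq_sum_translate_eight hlen t _
  have hweight : ∀ (l k : ℕ) (i : Fin 8) (u v : Bool), l * k = 12 →
      ((t + i, l) ∈ G → ((∃ q ∈ G, cyclicArc q ⊂ cyclicArc (t + i, l)) ↔ u = true)) →
      ((t + i, l) ∈ G → ((∃ q ∈ G, cyclicArc (t + i, l) ⊂ cyclicArc q) ↔ v = true)) →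
      (u = true → v = true → k = 4) → 12 * W l i = arcWeight (y l i) u v k := by
    intro l k i u v hlk hu hv huv
    by_cases hi : (t + i, l) ∈ G
    · have hl : (l : ℚ) ≠ 0 := by
        rintro h
        rw [Nat.cast_eq_zero] at h
        subst h
        simp at hlk
      have hk : (k : ℚ) = 12 / l := by
        rw [eq_div_iff hl, mul_comm]
        exact_mod_cast hlk
      have hk4 : u = true → v = true → (12 : ℚ) / l = 4 := fun h h' => by
        rw [← hk, huv h h']
        norm_num
      simp only [W, if_pos hi, lowerInd, upperInd, hu hi, hv hi, arcWeight, (hy l i).2 hi, if_true]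
      cases u <;> cases v <;> simp [hk]
      · ring
      · ring
      · ring
      · have := hk4 rfl rfl
        field_simp at this ⊢
        linarith
    · have : y l i = false := by rw [Bool.eq_false_iff, ne_eq, hy]; exact hi
      simp [W, hi, arcWeight, this]
  have hW2 : ∀ i, 12 * W 2 i = arcWeight (y 2 i) false
      (y 3 i || y 3 (i - 1) || y 4 i || y 4 (i - 1) || y 4 (i - 2)) 6 := by
    intro i
    refine hweight 2 6 i _ _ rfl (fun h => ?_) (fun h => ?_) (by simp)
    · simp [exists_cyclicArc_ssubset_iff_eight hlen h]
    · simp [exists_ssubset_cyclicArc_iff_eight hlen h, hy, add_sub_assoc, or_assoc]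
  have hW3 : ∀ i, 12 * W 3 i = arcWeight (y 3 i) (y 2 i || y 2 (i + 1))
      (y 4 i || y 4 (i - 1)) 4 := by
    intro i
    refine hweight 3 4 i _ _ rfl (fun h => ?_) (fun h => ?_) (fun _ _ => rfl)
    · simp [exists_cyclicArc_ssubset_iff_eight hlen h, hy, add_assoc]
    · simp [exists_ssubset_cyclicArc_iff_eight hlen h, hy, add_sub_assoc]
  have hW4 : ∀ i, 12 * W 4 i = arcWeight (y 4 i)
      (y 2 i || y 2 (i + 1) || y 2 (i + 2) || y 3 i || y 3 (i + 1)) false 3 := by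
    intro i
    refine hweight 4 3 i _ _ rfl (fun h => ?_) (fun h => ?_) (by simp)
    · simp [exists_cyclicArc_ssubset_iff_eight hlen h, hy, add_assoc, or_assoc]
    · simp [exists_ssubset_cyclicArc_iff_eight hlen h]
  have hfalse : ∀ (l : ℕ) (j : Fin 8), l ∈ Icc 2 4 → j.val ∈ Icc 2 (8 - l) → y l j = false := by
    intro l j hl hj
    have := hdis 2 (by decide) l hl 0 j ⟨j.val, hj, by
      have := j.isLt
      simp only [Fin.val_zero]
      omega⟩
    rwa [hy2, Bool.and_true] at this
  have hbound := eightWeight_le (y 2 7) (y 2 1) (y 3 6) (y 3 7) (y 3 0) (y 3 1) (y 4 5) (y 4 6)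
    (y 4 7) (y 4 0) (y 4 1)
    (by rw [Bool.and_comm]; exact hdis 2 (by decide) 2 (by decide) 7 1 (by decide))
    (hdis 2 (by decide) 3 (by decide) 1 6 (by decide))
    (by rw [Bool.and_comm]; exact hdis 3 (by decide) 2 (by decide) 1 7 (by decide))
    (hdis 3 (by decide) 3 (by decide) 6 1 (by decide))
    (hdis 2 (by decide) 4 (by decide) 1 5 (by decide))
    (hdis 3 (by decide) 4 (by decide) 1 5 (by decide))
    (hdis 2 (by decide) 4 (by decide) 7 1 (by decide))
    (hdis 3 (by decide) 4 (by decide) 6 1 (by decide))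
    (hdis 4 (by decide) 4 (by decide) 5 1 (by decide))
    (by simpa [hy2] using hbut 7)
    (by simpa [hy2, show (-1 : Fin 8) = 7 from rfl] using hbut 0)
  have htotal : 12 * (∑ i, W 2 i + ∑ i, W 3 i + ∑ i, W 4 i) =
      (eightWeight (y 2 7) (y 2 1) (y 3 6) (y 3 7) (y 3 0) (y 3 1) (y 4 5) (y 4 6)
        (y 4 7) (y 4 0) (y 4 1) : ℚ) := by
    have h22 : y 2 2 = false := hfalse 2 2 (by decide) (by decide)
    have h23 : y 2 3 = false := hfalse 2 3 (by decide) (by decide)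
    have h24 : y 2 4 = false := hfalse 2 4 (by decide) (by decide)
    have h25 : y 2 5 = false := hfalse 2 5 (by decide) (by decide)
    have h26 : y 2 6 = false := hfalse 2 6 (by decide) (by decide)
    have h32 : y 3 2 = false := hfalse 3 2 (by decide) (by decide)
    have h33 : y 3 3 = false := hfalse 3 3 (by decide) (by decide)
    have h34 : y 3 4 = false := hfalse 3 4 (by decide) (by decide)
    have h35 : y 3 5 = false := hfalse 3 5 (by decide) (by decide)
    have h42 : y 4 2 = false := hfalse 4 2 (by decide) (by decide)
    have h43 : y 4 3 = false := hfalse 4 3 (by decide) (by decide)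
    have h44 : y 4 4 = false := hfalse 4 4 (by decide) (by decide)
    have hw0 : ∀ u v k, arcWeight false u v k = 0 := fun _ _ _ => rfl
    rw [mul_add, mul_add, mul_sum, mul_sum, mul_sum]
    simp only [hW2, hW3, hW4, Fin.sum_univ_eight, eightWeight, hy2, h22, h23, h24, h25, h26, h32,
      h33, h34, h35, h42, h43, h44, hw0, Fin.reduceAdd, Fin.reduceSub, Bool.or_false,
      Bool.false_or, Bool.or_true, Bool.true_or, zero_add, zero_sub, show (-1 : Fin 8) = 7 from rfl,
      show (-2 : Fin 8) = 6 from rfl,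
      Nat.cast_add, Nat.cast_zero, add_zero]
    ring
  rw [hsum]
  have : ((eightWeight (y 2 7) (y 2 1) (y 3 6) (y 3 7) (y 3 0) (y 3 1) (y 4 5) (y 4 6)
        (y 4 7) (y 4 0) (y 4 1) : ℕ) : ℚ) ≤ 24 := by exact_mod_cast hbound
  linarith

/-- The number of steps from `x` to `y` on the cycle. -/
def cyclicOffset {n : ℕ} (x y : Fin n) : ℕ :=
  if x.val ≤ y.val then y.val - x.val else y.val + n - x.val

theorem cyclicOffset_add_le_of_subset {n : ℕ} {p q : Fin n × ℕ} (hq : 0 < q.2)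
    (hp : 2 * p.2 ≤ n) (hqp : q.2 ≤ p.2) (h : cyclicArc q ⊆ cyclicArc p) :
    cyclicOffset p.1 q.1 + q.2 ≤ p.2 := by
  have hp1 := p.1.isLt
  have hq1 := q.1.isLt
  have h1 : q.1 ∈ cyclicArc p := h (mem_cyclicArc.2 (by omega))
  have h2 : (⟨if q.1.val + (q.2 - 1) < n then q.1.val + (q.2 - 1)
      else q.1.val + (q.2 - 1) - n, by split_ifs <;> omega⟩ : Fin n) ∈ cyclicArc p := by
    refine h (mem_cyclicArc.2 ?_)
    dsimp only
    split_ifs <;> omega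
  rw [mem_cyclicArc] at h1 h2
  dsimp only at h2
  unfold cyclicOffset
  split_ifs at h2 ⊢ <;> omega

theorem card_start_subset_le {n : ℕ} {p : Fin n × ℕ} {a : ℕ} (ha : 0 < a) (hap : a ≤ p.2)
    (hp : 2 * p.2 ≤ n) :
    (univ.filter fun x : Fin n => cyclicArc (x, a) ⊆ cyclicArc p).card ≤ p.2 - a + 1 := by
  conv_rhs => rw [← card_range (p.2 - a + 1)]
  refine card_le_card_of_injOn (fun x => cyclicOffset p.1 x) (fun x hx => ?_) fun x _ y _ h => ?_
  · have := cyclicOffset_add_le_of_subset (q := (x, a)) ha hp hap (by simpa using hx)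
    dsimp only at this
    simp only [coe_range, Set.mem_Iio]
    omega
  · have hx := x.isLt
    have hy := y.isLt
    ext
    dsimp only [cyclicOffset] at h
    split_ifs at h <;> omega

theorem card_start_superset_le {n : ℕ} {p : Fin n × ℕ} {c : ℕ} (hp : 0 < p.2) (hpc : p.2 ≤ c)
    (hc : 2 * c ≤ n) :
    (univ.filter fun x : Fin n => cyclicArc p ⊆ cyclicArc (x, c)).card ≤ c - p.2 + 1 := by
  conv_rhs => rw [← card_range (c - p.2 + 1)]
  refine card_le_card_of_injOn (fun x => cyclicOffset x p.1) (fun x hx => ?_) fun x _ y _ h => ?_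
  · have := cyclicOffset_add_le_of_subset (p := (x, c)) hp hc hpc (by simpa using hx)
    dsimp only at this
    simp only [coe_range, Set.mem_Iio]
    omega
  · have hx := x.isLt
    have hy := y.isLt
    have hp := p.1.isLt
    ext
    dsimp only [cyclicOffset] at h
    split_ifs at h <;> omega

theorem two_le_card_start_eight : ∀ x : Fin 8,
    2 ≤ (univ.filter fun y : Fin 8 => cyclicArc (y, 2) ⊆ cyclicArc (x, 3)).card ∧
    2 ≤ (univ.filter fun y : Fin 8 => cyclicArc (x, 3) ⊆ cyclicArc (y, 4)).card := by
  decide +kernel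

/-- The arcs of length between `2` and `n / 2` that `g` maps to members of `F`. -/
def arcFamily {n : ℕ} (F : Finset (Finset (Fin n))) (g : Equiv.Perm (Fin n)) :
    Finset (Fin n × ℕ) :=
  (univ ×ˢ Icc 2 (n / 2)).filter fun p => (cyclicArc p).map g.toEmbedding ∈ F

theorem mem_arcFamily {n : ℕ} {F : Finset (Finset (Fin n))} {g : Equiv.Perm (Fin n)}
    {p : Fin n × ℕ} :
    p ∈ arcFamily F g ↔ (2 ≤ p.2 ∧ 2 * p.2 ≤ n) ∧ (cyclicArc p).map g.toEmbedding ∈ F := by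
  simp only [arcFamily, mem_filter, mem_product, mem_univ, mem_Icc, true_and]
  rw [Nat.le_div_iff_mul_le two_pos, mul_comm 2 p.2]

theorem card_perm_lower_le {n : ℕ} {F : Finset (Finset (Fin n))} {p : Fin n × ℕ}
    {A B : Finset (Fin n)} (hpn : 2 * p.2 ≤ n) (hpB : p.2 = B.card) (hA : 0 < A.card)
    (hAB : A ⊆ B) (huniq : ∀ A' ∈ F, A' ⊂ B → A' = A) :
    (univ.filter fun g : Equiv.Perm (Fin n) => (cyclicArc p).map g.toEmbedding = B ∧
        ∃ q ∈ arcFamily F g, cyclicArc q ⊂ cyclicArc p).card * B.card.choose A.card ≤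
      (B.card - A.card + 1) *
        (univ.filter fun g : Equiv.Perm (Fin n) => (cyclicArc p).map g.toEmbedding = B).card := by
  have hcard := card_le_card hAB
  let S := univ.filter fun x : Fin n => cyclicArc (x, A.card) ⊆ cyclicArc p
  have hsub : (univ.filter fun g : Equiv.Perm (Fin n) => (cyclicArc p).map g.toEmbedding = B ∧
      ∃ q ∈ arcFamily F g, cyclicArc q ⊂ cyclicArc p) ⊆
      S.biUnion fun x => univ.filter fun g : Equiv.Perm (Fin n) =>
        (cyclicArc (x, A.card)).map g.toEmbedding = A ∧ (cyclicArc p).map g.toEmbedding = B := by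
    intro g hg
    obtain ⟨hgB, ⟨x, l⟩, hq, hqp⟩ := (mem_filter.1 hg).2
    rw [mem_arcFamily] at hq
    have hqA := huniq _ hq.2 (hgB ▸ map_ssubset_map.2 hqp)
    obtain rfl : l = A.card := by
      rw [← hqA, card_map, card_cyclicArc _ (by linarith [hq.1.2])]
    exact mem_biUnion.2 ⟨x, mem_filter.2 ⟨mem_univ _, hqp.1⟩, mem_filter.2 ⟨mem_univ _, hqA, hgB⟩⟩
  have hS : S.card ≤ B.card - A.card + 1 := by
    rw [← hpB]
    exact card_start_subset_le hA (by omega) hpn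
  calc _ ≤ (∑ x ∈ S, (univ.filter fun g : Equiv.Perm (Fin n) =>
        (cyclicArc (x, A.card)).map g.toEmbedding = A ∧
          (cyclicArc p).map g.toEmbedding = B).card) * B.card.choose A.card :=
        Nat.mul_le_mul_right _ ((card_le_card hsub).trans card_biUnion_le)
    _ = ∑ x ∈ S, (univ.filter fun g : Equiv.Perm (Fin n) =>
        (cyclicArc p).map g.toEmbedding = B).card := by
        rw [sum_mul]
        refine sum_congr rfl fun x hx => card_perm_lower_mul_choose (mem_filter.1 hx).2 hAB ?_ ?_
        · exact card_cyclicArc _ (by dsimp only; omega)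
        · rw [card_cyclicArc _ (by omega), hpB]
    _ ≤ _ := by
        rw [sum_const, smul_eq_mul]
        exact Nat.mul_le_mul_right _ hS

theorem card_perm_upper_le {n : ℕ} {F : Finset (Finset (Fin n))} {p : Fin n × ℕ}
    {B C : Finset (Fin n)} (hp : 0 < p.2) (hpB : p.2 = B.card) (hC : 2 * C.card ≤ n)
    (hBC : B ⊆ C) (huniq : ∀ C' ∈ F, B ⊂ C' → C' = C) :
    (univ.filter fun g : Equiv.Perm (Fin n) => (cyclicArc p).map g.toEmbedding = B ∧
        ∃ q ∈ arcFamily F g, cyclicArc p ⊂ cyclicArc q).card *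
          (n - B.card).choose (C.card - B.card) ≤
      (C.card - B.card + 1) *
        (univ.filter fun g : Equiv.Perm (Fin n) => (cyclicArc p).map g.toEmbedding = B).card := by
  have hcard := card_le_card hBC
  let S := univ.filter fun x : Fin n => cyclicArc p ⊆ cyclicArc (x, C.card)
  have hsub : (univ.filter fun g : Equiv.Perm (Fin n) => (cyclicArc p).map g.toEmbedding = B ∧
      ∃ q ∈ arcFamily F g, cyclicArc p ⊂ cyclicArc q) ⊆
      S.biUnion fun x => univ.filter fun g : Equiv.Perm (Fin n) =>
        (cyclicArc p).map g.toEmbedding = B ∧ (cyclicArc (x, C.card)).map g.toEmbedding = C := by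
    intro g hg
    obtain ⟨hgB, ⟨x, l⟩, hq, hpq⟩ := (mem_filter.1 hg).2
    rw [mem_arcFamily] at hq
    have hqC := huniq _ hq.2 (hgB ▸ map_ssubset_map.2 hpq)
    obtain rfl : l = C.card := by
      rw [← hqC, card_map, card_cyclicArc _ (by linarith [hq.1.2])]
    exact mem_biUnion.2 ⟨x, mem_filter.2 ⟨mem_univ _, hpq.1⟩, mem_filter.2 ⟨mem_univ _, hgB, hqC⟩⟩
  have hS : S.card ≤ C.card - B.card + 1 := by
    rw [← hpB]
    exact card_start_superset_le hp (by omega) hC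
  calc _ ≤ (∑ x ∈ S, (univ.filter fun g : Equiv.Perm (Fin n) =>
        (cyclicArc p).map g.toEmbedding = B ∧ (cyclicArc (x, C.card)).map g.toEmbedding = C).card) *
          (n - B.card).choose (C.card - B.card) :=
        Nat.mul_le_mul_right _ ((card_le_card hsub).trans card_biUnion_le)
    _ = ∑ x ∈ S, (univ.filter fun g : Equiv.Perm (Fin n) =>
        (cyclicArc p).map g.toEmbedding = B).card := by
        rw [sum_mul]
        refine sum_congr rfl fun x hx => ?_
        have := card_perm_upper_mul_choose (mem_filter.1 hx).2 hBC
          (by rw [card_cyclicArc _ (by omega), hpB]) (card_cyclicArc (x, C.card) (by dsimp only; omega))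
        rwa [Fintype.card_fin] at this
    _ ≤ _ := by
        rw [sum_const, smul_eq_mul]
        exact Nat.mul_le_mul_right _ hS

theorem four_mul_card_perm_le_eight {F : Finset (Finset (Fin 8))} {p : Fin 8 × ℕ}
    {A B C : Finset (Fin 8)} (hA : A ∈ F) (hC : C ∈ F) (hAB : A ⊆ B) (hBC : B ⊆ C)
    (hp : p.2 = 3) (hA2 : A.card = 2) (hB3 : B.card = 3) (hC4 : C.card = 4) :
    4 * (univ.filter fun g : Equiv.Perm (Fin 8) => (cyclicArc p).map g.toEmbedding = B).card ≤
      15 * (univ.filter fun g : Equiv.Perm (Fin 8) => (cyclicArc p).map g.toEmbedding = B ∧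
        (∃ q ∈ arcFamily F g, cyclicArc q ⊂ cyclicArc p) ∧
          ∃ q ∈ arcFamily F g, cyclicArc p ⊂ cyclicArc q).card := by
  obtain ⟨t, l⟩ := p
  dsimp only at hp
  subst hp
  let S := (univ.filter fun x : Fin 8 => cyclicArc (x, 2) ⊆ cyclicArc (t, 3)) ×ˢ
    (univ.filter fun x : Fin 8 => cyclicArc (t, 3) ⊆ cyclicArc (x, 4))
  let T : Fin 8 × Fin 8 → Finset (Equiv.Perm (Fin 8)) := fun x => univ.filter fun g =>
    (cyclicArc (x.1, 2)).map g.toEmbedding = A ∧ (cyclicArc (t, 3)).map g.toEmbedding = B ∧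
      (cyclicArc (x.2, 4)).map g.toEmbedding = C
  have hS : 4 ≤ S.card := by
    rw [card_product]
    exact Nat.mul_le_mul (two_le_card_start_eight t).1 (two_le_card_start_eight t).2
  have hT : ∀ x ∈ S, (T x).card * 15 = (univ.filter fun g : Equiv.Perm (Fin 8) =>
      (cyclicArc (t, 3)).map g.toEmbedding = B).card := by
    intro x hx
    have hx := mem_product.1 hx
    have := card_perm_flag (mem_filter.1 hx.1).2 (mem_filter.1 hx.2).2 hAB hBC
      (by rw [card_cyclicArc _ (by norm_num), hA2]) (by rw [card_cyclicArc _ (by norm_num), hC4])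
    rw [Fintype.card_fin, hA2, hB3, hC4] at this
    exact this
  have hdisj : (S : Set (Fin 8 × Fin 8)).PairwiseDisjoint T := by
    intro x _ y _ hxy
    refine disjoint_left.2 fun g hgx hgy => hxy ?_
    have hgx := (mem_filter.1 hgx).2
    have hgy := (mem_filter.1 hgy).2
    have h1 := cyclicArc_injOn (by norm_num) (by norm_num) (by norm_num)
      (map_injective _ (hgx.1.trans hgy.1.symm))
    have h2 := cyclicArc_injOn (by norm_num) (by norm_num) (by norm_num)
      (map_injective _ (hgx.2.2.trans hgy.2.2.symm))
    exact Prod.ext (Prod.mk.inj h1).1 (Prod.mk.inj h2).1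
  have hsub : S.biUnion T ⊆ univ.filter fun g : Equiv.Perm (Fin 8) =>
      (cyclicArc (t, 3)).map g.toEmbedding = B ∧
        (∃ q ∈ arcFamily F g, cyclicArc q ⊂ cyclicArc (t, 3)) ∧
          ∃ q ∈ arcFamily F g, cyclicArc (t, 3) ⊂ cyclicArc q := by
    intro g hg
    obtain ⟨x, hx, hg⟩ := mem_biUnion.1 hg
    have hx := mem_product.1 hx
    have hg := (mem_filter.1 hg).2
    refine mem_filter.2 ⟨mem_univ _, hg.2.1, ⟨(x.1, 2), mem_arcFamily.2 ⟨by norm_num, ?_⟩, ?_⟩,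
      (x.2, 4), mem_arcFamily.2 ⟨by norm_num, ?_⟩, ?_⟩
    · rw [hg.1]
      exact hA
    · refine ssubset_of_subset_of_ne (mem_filter.1 hx.1).2 fun h => ?_
      have := congrArg card h
      rw [card_cyclicArc _ (by norm_num), card_cyclicArc _ (by norm_num)] at this
      norm_num at this
    · rw [hg.2.2]
      exact hC
    · refine ssubset_of_subset_of_ne (mem_filter.1 hx.2).2 fun h => ?_
      have := congrArg card h
      rw [card_cyclicArc _ (by norm_num), card_cyclicArc _ (by norm_num)] at this
      norm_num at this
  calc _ ≤ S.card * (univ.filter fun g : Equiv.Perm (Fin 8) =>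
        (cyclicArc (t, 3)).map g.toEmbedding = B).card := Nat.mul_le_mul_right _ hS
    _ = ∑ x ∈ S, (T x).card * 15 := by rw [sum_congr rfl hT, sum_const, smul_eq_mul]
    _ = 15 * (S.biUnion T).card := by rw [card_biUnion hdisj, ← sum_mul, mul_comm]
    _ ≤ _ := Nat.mul_le_mul_left _ (card_le_card hsub)

/-- The coefficient of the product of the two indicators in the weight of an arc. -/
def overlapCoeff (n : ℕ) : ℚ := if n = 8 then 1 / 4 else 0

theorem overlapCoeff_nonneg (n : ℕ) : 0 ≤ overlapCoeff n := by
  unfold overlapCoeff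
  split_ifs <;> norm_num

/-- The weight of an arc `p` relative to a set `G` of arcs, before division by its length. -/
def chainWeight {n : ℕ} (G : Finset (Fin n × ℕ)) (p : Fin n × ℕ) : ℚ :=
  2 - lowerInd G p - upperInd G p + overlapCoeff n * (lowerInd G p * upperInd G p)

theorem card_filter_perm_le {n : ℕ} {F : Finset (Finset (Fin n))} (hbut : ButterflyFree F)
    (hsize : ∀ A ∈ F, 2 ≤ A.card ∧ 2 * A.card ≤ n) {B : Finset (Fin n)} (hB : B ∈ F)
    (p : Fin n × ℕ) (hpB : p.2 = B.card) :
    ((univ.filter fun g : Equiv.Perm (Fin n) => (cyclicArc p).map g.toEmbedding = B ∧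
        ∃ q ∈ arcFamily F g, cyclicArc q ⊂ cyclicArc p).card : ℚ) +
      (univ.filter fun g : Equiv.Perm (Fin n) => (cyclicArc p).map g.toEmbedding = B ∧
        ∃ q ∈ arcFamily F g, cyclicArc p ⊂ cyclicArc q).card ≤
      (univ.filter fun g : Equiv.Perm (Fin n) => (cyclicArc p).map g.toEmbedding = B).card +
      overlapCoeff n * (univ.filter fun g : Equiv.Perm (Fin n) =>
        (cyclicArc p).map g.toEmbedding = B ∧
        (∃ q ∈ arcFamily F g, cyclicArc q ⊂ cyclicArc p) ∧
          ∃ q ∈ arcFamily F g, cyclicArc p ⊂ cyclicArc q).card := by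
  set N := (univ.filter fun g : Equiv.Perm (Fin n) =>
    (cyclicArc p).map g.toEmbedding = B).card with hN
  set L := (univ.filter fun g : Equiv.Perm (Fin n) => (cyclicArc p).map g.toEmbedding = B ∧
        ∃ q ∈ arcFamily F g, cyclicArc q ⊂ cyclicArc p).card with hL
  set U := (univ.filter fun g : Equiv.Perm (Fin n) => (cyclicArc p).map g.toEmbedding = B ∧
        ∃ q ∈ arcFamily F g, cyclicArc p ⊂ cyclicArc q).card with hU
  set M := (univ.filter fun g : Equiv.Perm (Fin n) =>
        (cyclicArc p).map g.toEmbedding = B ∧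
        (∃ q ∈ arcFamily F g, cyclicArc q ⊂ cyclicArc p) ∧
          ∃ q ∈ arcFamily F g, cyclicArc p ⊂ cyclicArc q).card with hM
  have hδM : 0 ≤ overlapCoeff n * M := mul_nonneg (overlapCoeff_nonneg n) (Nat.cast_nonneg _)
  have hB2 := hsize B hB
  suffices h : L + U ≤ N ∨ overlapCoeff n = 1 / 4 ∧ 4 * (L + U) ≤ 4 * N + M by
    rcases h with h | ⟨h, h'⟩
    · have : (L : ℚ) + U ≤ N := by exact_mod_cast h
      linarith
    · have : 4 * ((L : ℚ) + U) ≤ 4 * N + M := by exact_mod_cast h'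
      rw [h]
      linarith
  have hLN : L ≤ N := card_le_card fun g hg =>
    mem_filter.2 ⟨mem_univ _, (mem_filter.1 hg).2.1⟩
  have hUN : U ≤ N := card_le_card fun g hg =>
    mem_filter.2 ⟨mem_univ _, (mem_filter.1 hg).2.1⟩
  by_cases hlow : ∃ A ∈ F, A ⊂ B
  swap
  · have : L = 0 := by
      rw [hL, card_eq_zero, filter_eq_empty_iff]
      rintro g - ⟨hg, q, hq, hqp⟩
      exact hlow ⟨_, (mem_arcFamily.1 hq).2, hg ▸ map_ssubset_map.2 hqp⟩
    omega
  by_cases hupp : ∃ C ∈ F, B ⊂ C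
  swap
  · have : U = 0 := by
      rw [hU, card_eq_zero, filter_eq_empty_iff]
      rintro g - ⟨hg, q, hq, hpq⟩
      exact hupp ⟨_, (mem_arcFamily.1 hq).2, hg ▸ map_ssubset_map.2 hpq⟩
    omega
  obtain ⟨A, hA, hAB⟩ := hlow
  obtain ⟨C, hC, hBC⟩ := hupp
  have hA2 := hsize A hA
  have hC2 := hsize C hC
  have hab := card_lt_card hAB
  have hbc := card_lt_card hBC
  have huA : ∀ A' ∈ F, A' ⊂ B → A' = A := by
    intro A' hA' h
    by_contra hne
    exact hbut ⟨A', A, B, C, hA', hA, hB, hC, hne, h.ne, (h.trans hBC).ne, hAB.ne,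
      (hAB.trans hBC).ne, hBC.ne, h.1, (h.trans hBC).1, hAB.1, (hAB.trans hBC).1⟩
  have huC : ∀ C' ∈ F, B ⊂ C' → C' = C := by
    intro C' hC' h
    by_contra hne
    exact hbut ⟨A, B, C', C, hA, hB, hC', hC, hAB.ne, (hAB.trans h).ne, (hAB.trans hBC).ne,
      h.ne, hBC.ne, hne, (hAB.trans h).1, (hAB.trans hBC).1, h.1, hBC.1⟩
  have hlower := card_perm_lower_le (by omega) hpB (by omega) hAB.1 huA
  have hupper := card_perm_upper_le (by omega) hpB hC2.2 hBC.1 huC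
  rw [← hL, ← hN] at hlower
  rw [← hU, ← hN] at hupper
  have hL3 : 3 * L ≤ 2 * N := by
    have h1 := three_mul_le_two_mul_choose hA2.1 hab
    refine Nat.le_of_mul_le_mul_right ?_ (Nat.choose_pos hab.le)
    calc 3 * L * B.card.choose A.card = 3 * (L * B.card.choose A.card) := by ring
      _ ≤ 3 * ((B.card - A.card + 1) * N) := Nat.mul_le_mul_left _ hlower
      _ = 3 * (B.card - A.card + 1) * N := by ring
      _ ≤ 2 * B.card.choose A.card * N := Nat.mul_le_mul_right _ h1
      _ = 2 * N * B.card.choose A.card := by ring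
  by_cases hn : n = 8
  · subst hn
    have ha : A.card = 2 := by omega
    have hb : B.card = 3 := by omega
    have hc : C.card = 4 := by omega
    have hM15 := four_mul_card_perm_le_eight hA hC hAB.1 hBC.1 (hpB.trans hb) ha hb hc
    rw [← hM, ← hN] at hM15
    rw [hb, hc] at hupper
    norm_num at hupper
    exact Or.inr ⟨if_pos rfl, by omega⟩
  · have h1 : 3 * (C.card - B.card + 1) ≤ (n - B.card).choose (C.card - B.card) :=
      three_mul_le_choose (by omega) (by omega)
    have hU3 : 3 * U ≤ N := by
      refine Nat.le_of_mul_le_mul_right ?_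
        (Nat.choose_pos (show C.card - B.card ≤ n - B.card by omega))
      calc 3 * U * (n - B.card).choose (C.card - B.card) =
            3 * (U * (n - B.card).choose (C.card - B.card)) := by ring
        _ ≤ 3 * ((C.card - B.card + 1) * N) := Nat.mul_le_mul_left _ hupper
        _ = 3 * (C.card - B.card + 1) * N := by ring
        _ ≤ (n - B.card).choose (C.card - B.card) * N := Nat.mul_le_mul_right _ h1
        _ = N * (n - B.card).choose (C.card - B.card) := by ring
    left
    omega

theorem card_le_sum_chainWeight {n : ℕ} {F : Finset (Finset (Fin n))} (hbut : ButterflyFree F)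
    (hsize : ∀ A ∈ F, 2 ≤ A.card ∧ 2 * A.card ≤ n) {B : Finset (Fin n)} (hB : B ∈ F)
    (p : Fin n × ℕ) (hpB : p.2 = B.card) :
    ((univ.filter fun g : Equiv.Perm (Fin n) => (cyclicArc p).map g.toEmbedding = B).card : ℚ) ≤
      ∑ g : Equiv.Perm (Fin n) with (cyclicArc p).map g.toEmbedding = B,
        chainWeight (arcFamily F g) p := by
  have h := card_filter_perm_le hbut hsize hB p hpB
  have hmul : ∀ G : Finset (Fin n × ℕ), lowerInd G p * upperInd G p =
      if (∃ q ∈ G, cyclicArc q ⊂ cyclicArc p) ∧ ∃ q ∈ G, cyclicArc p ⊂ cyclicArc q then 1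
      else 0 := fun G => by
    unfold lowerInd upperInd
    rw [ite_and]
    split_ifs <;> simp
  simp only [chainWeight, sum_add_distrib, sum_sub_distrib, ← mul_sum, hmul]
  simp only [lowerInd, upperInd, sum_boole, filter_filter, sum_const, nsmul_eq_mul]
  linarith

theorem sum_chainWeight_le {n : ℕ} {F : Finset (Finset (Fin n))} (hint : Intersecting F)
    (hbut : ButterflyFree F) (g : Equiv.Perm (Fin n)) :
    ∑ p ∈ arcFamily F g, (1 : ℚ) / p.2 * chainWeight (arcFamily F g) p ≤ 2 := by
  have hsize : ∀ p ∈ arcFamily F g, 2 ≤ p.2 ∧ 2 * p.2 ≤ n := fun p hp => (mem_arcFamily.1 hp).1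
  have hmeet : ∀ p ∈ arcFamily F g, ∀ q ∈ arcFamily F g,
      (cyclicArc p ∩ cyclicArc q).Nonempty := by
    intro p hp q hq
    have := hint _ (mem_arcFamily.1 hp).2 _ (mem_arcFamily.1 hq).2
    rwa [← map_inter, map_nonempty] at this
  by_cases hn : n = 8
  · subst hn
    have := sum_minimal_add_maximal_le_eight (arcFamily F g) hsize hmeet ?_
    · simpa only [chainWeight, overlapCoeff, if_true] using this
    · intro p hp q hq r hr s hs hpq hrs hpr hps hqr hqs
      have hne : ∀ x ∈ arcFamily F g, ∀ z ∈ arcFamily F g, x ≠ z →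
          (cyclicArc x).map g.toEmbedding ≠ (cyclicArc z).map g.toEmbedding :=
        fun x hx z hz hxz h => hxz (cyclicArc_injOn (by linarith [(hsize x hx).1])
          (hsize x hx).2 (hsize z hz).2 (map_injective _ h))
      have hss : ∀ {x z : Fin 8 × ℕ}, cyclicArc x ⊂ cyclicArc z →
          (cyclicArc x).map g.toEmbedding ⊂ (cyclicArc z).map g.toEmbedding :=
        fun h => map_ssubset_map.2 h
      exact hbut ⟨_, _, _, _, (mem_arcFamily.1 hp).2, (mem_arcFamily.1 hq).2,
        (mem_arcFamily.1 hr).2, (mem_arcFamily.1 hs).2, hne p hp q hq hpq, (hss hpr).ne,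
        (hss hps).ne, (hss hqr).ne, (hss hqs).ne, hne r hr s hs hrs, (hss hpr).1, (hss hps).1,
        (hss hqr).1, (hss hqs).1⟩
  · simpa only [chainWeight, overlapCoeff, if_neg hn, zero_mul, add_zero] using
      sum_minimal_add_maximal_le (arcFamily F g) hsize hmeet

theorem sum_card_perm_div {n : ℕ} {B : Finset (Fin n)} (hB : 2 ≤ B.card ∧ 2 * B.card ≤ n) :
    ∑ p ∈ (univ : Finset (Fin n)) ×ˢ Icc 2 (n / 2), (1 : ℚ) / p.2 *
      (univ.filter fun g : Equiv.Perm (Fin n) => (cyclicArc p).map g.toEmbedding = B).card =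
      n.factorial * ((1 : ℚ) / (n - 1).choose (B.card - 1)) := by
  have hmem : B.card ∈ Icc 2 (n / 2) := mem_Icc.2 ⟨hB.1, by omega⟩
  have hC : (n.choose B.card : ℚ) ≠ 0 := by
    exact_mod_cast (Nat.choose_pos (show B.card ≤ n by omega)).ne'
  have hC' : ((n - 1).choose (B.card - 1) : ℚ) ≠ 0 := by
    exact_mod_cast (Nat.choose_pos (show B.card - 1 ≤ n - 1 by omega)).ne'
  have hb : (B.card : ℚ) ≠ 0 := by
    exact_mod_cast (show B.card ≠ 0 by omega)
  have hmul : (n : ℚ) * (n - 1).choose (B.card - 1) = n.choose B.card * B.card := by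
    have := Nat.add_one_mul_choose_eq (n - 1) (B.card - 1)
    rw [Nat.sub_add_cancel (by omega), Nat.sub_add_cancel (by omega)] at this
    exact_mod_cast this
  rw [sum_product_right, sum_eq_single_of_mem _ hmem]
  · dsimp only
    rw [← mul_sum, sum_congr rfl (g := fun _ => (n.factorial : ℚ) / n.choose B.card)]
    · rw [sum_const, card_univ, Fintype.card_fin, nsmul_eq_mul]
      field_simp
      linear_combination hmul
    · intro x _
      rw [eq_div_iff hC]
      have := card_perm_map_eq_mul_choose
        (card_cyclicArc (x, B.card) (by dsimp only; omega))
      rw [Fintype.card_fin] at this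
      exact_mod_cast this
  · intro l hl hne
    refine sum_eq_zero fun x _ => ?_
    rw [filter_eq_empty_iff.2, card_empty, Nat.cast_zero, mul_zero]
    rintro g - h
    refine hne ?_
    rw [mem_Icc] at hl
    rw [← h, card_map, card_cyclicArc _ (by dsimp only; omega)]

theorem bollobas_type_inequality (n : ℕ) (F : Finset (Finset (Fin n)))
    (hF : Intersecting F) (hB : ButterflyFree F)
    (hsize : ∀ A ∈ F, 2 ≤ A.card ∧ 2 * A.card ≤ n) :
    ∑ A ∈ F, (1 : ℚ) / (Nat.choose (n - 1) (A.card - 1)) ≤ 2 := by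
  have hfac : (0 : ℚ) < n.factorial := by exact_mod_cast n.factorial_pos
  refine le_of_mul_le_mul_left ?_ hfac
  calc (n.factorial : ℚ) * ∑ A ∈ F, (1 : ℚ) / (Nat.choose (n - 1) (A.card - 1)) =
        ∑ A ∈ F, ∑ p ∈ (univ : Finset (Fin n)) ×ˢ Icc 2 (n / 2), (1 : ℚ) / p.2 *
          (univ.filter fun g : Equiv.Perm (Fin n) =>
            (cyclicArc p).map g.toEmbedding = A).card := by
        rw [mul_sum]
        exact sum_congr rfl fun A hA => (sum_card_perm_div (hsize A hA)).symm
    _ ≤ ∑ A ∈ F, ∑ p ∈ (univ : Finset (Fin n)) ×ˢ Icc 2 (n / 2), (1 : ℚ) / p.2 *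
          ∑ g : Equiv.Perm (Fin n) with (cyclicArc p).map g.toEmbedding = A,
            chainWeight (arcFamily F g) p := by
        refine sum_le_sum fun A hA => sum_le_sum fun p hp => ?_
        refine mul_le_mul_of_nonneg_left ?_ (by positivity)
        by_cases hpA : p.2 = A.card
        · exact card_le_sum_chainWeight hB hsize hA p hpA
        · rw [filter_eq_empty_iff.2, card_empty, Nat.cast_zero, sum_empty]
          rintro g - h
          have := mem_Icc.1 (mem_product.1 hp).2
          exact hpA (by rw [← h, card_map, card_cyclicArc _ (by omega)])
    _ = ∑ g : Equiv.Perm (Fin n), ∑ p ∈ arcFamily F g,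
          (1 : ℚ) / p.2 * chainWeight (arcFamily F g) p := by
        simp only [arcFamily, sum_filter, mul_sum]
        rw [sum_comm, sum_comm (s := univ)]
        refine sum_congr rfl fun p _ => ?_
        rw [sum_comm]
        refine sum_congr rfl fun g _ => ?_
        simp only [mul_ite, mul_zero, sum_ite_eq]
    _ ≤ ∑ _g : Equiv.Perm (Fin n), (2 : ℚ) := sum_le_sum fun g _ => sum_chainWeight_le hF hB g
    _ = n.factorial * 2 := by
        rw [sum_const, card_univ, Fintype.card_perm, Fintype.card_fin, nsmul_eq_mul]
end

section
/- Let n ≥ 4 be odd, let P be a finite nonempty poset such that |P| + h(P) is even, where h(P) denotes the maximum size of a chain in P. Let F be an intersecting P-free family of subsets of [n]. Then |F| ≤ Σ_{i=1}^{(|P|+h(P))/2 − 1} C(n, ⌊n/2⌋ + i). -/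
/-- `F` contains the poset `P` as a subposet. -/
def ContainsPoset {α : Type*} (P : Type*) [PartialOrder P]
    (F : Finset (Finset α)) : Prop :=
  ∃ φ : P → Finset α, Function.Injective φ ∧ (∀ p, φ p ∈ F) ∧
    ∀ p q : P, p ≤ q → φ p ⊆ φ q

open Finset

/-- The least `r` elements of a finite set of naturals form an initial segment. -/
theorem exists_card_filter_lt_eq (S : Finset ℕ) {r : ℕ} (hr : r ≤ #S) :
    ∃ t, #{x ∈ S | x < t} = r := by
  classical
  have hex : ∃ t, r ≤ #{x ∈ S | x < t} := by
    refine ⟨S.sup id + 1, ?_⟩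
    rwa [filter_true_of_mem]
    exact fun x hx => Nat.lt_add_one_of_le (le_sup (f := id) hx)
  refine ⟨Nat.find hex, le_antisymm ?_ (Nat.find_spec hex)⟩
  rcases h0 : Nat.find hex with _ | t
  · simp
  · have hlt : #{x ∈ S | x < t} < r := not_le.1 (Nat.find_min hex (by omega))
    have hsub : {x ∈ S | x < t + 1} ⊆ insert t {x ∈ S | x < t} := by
      intro x hx
      simp only [mem_filter, mem_insert] at hx ⊢
      have := hx.1
      by_cases hxt : x = t
      · exact .inl hxt
      · exact .inr ⟨this, by omega⟩
    have := (card_le_card hsub).trans (card_insert_le _ _)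
    omega

/-- The order of the infinite double chain, whose `i`-th level consists of `2 * i`
and `2 * i + 1`. -/
def DoubleChainLE (p q : ℕ) : Prop :=
  p = q ∨ p < q ∧ (p % 2 = 1 ∨ p + 3 ≤ q)

/-- A finite map between finsets of suitable sizes can be chosen injective. -/
theorem exists_injOn_of_card_le {α β : Type*} [Nonempty β] {M : Finset α} {G : Finset β}
    (hMG : #M ≤ #G) : ∃ f : α → β, Set.InjOn f M ∧ ∀ x ∈ M, f x ∈ G := by
  classical
  obtain ⟨f⟩ : Nonempty (M ↪ G) := Function.Embedding.nonempty_of_card_le (by simpa using hMG)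
  refine ⟨fun x => if hx : x ∈ M then f ⟨x, hx⟩ else Classical.arbitrary β, ?_, ?_⟩
  · intro x hx y hy hxy
    rw [mem_coe] at hx hy
    simp only [hx, hy, dif_pos] at hxy
    simpa using f.injective (Subtype.ext hxy)
  · intro x hx
    simp [hx]

/-- A poset `Q` with no chain of length `h + 2` embeds into every subset of size `|Q| + h`
of the double chain. -/
theorem exists_doubleChain_embedding {P : Type*} [PartialOrder P] (h : ℕ) :
    ∀ (Q : Finset P) (S : Finset ℕ),
      (¬ ∃ c : Fin (h + 2) → P, StrictMono c ∧ ∀ i, c i ∈ Q) → #Q + h ≤ #S →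
      ∃ φ : P → ℕ, Set.InjOn φ Q ∧ (∀ p ∈ Q, φ p ∈ S) ∧
        ∀ p ∈ Q, ∀ q ∈ Q, p ≤ q → DoubleChainLE (φ p) (φ q) := by
  classical
  induction h with
  | zero =>
    intro Q S hQ hS
    obtain ⟨φ, hinj, hmem⟩ := exists_injOn_of_card_le (M := Q) (G := S) (by omega)
    refine ⟨φ, hinj, hmem, fun p hp q hq hpq => ?_⟩
    rcases hpq.eq_or_lt with rfl | hlt
    · exact .inl rfl
    · refine absurd ⟨![p, q], ?_, ?_⟩ hQ
      · intro i j hij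
        fin_cases i <;> fin_cases j <;> simp_all
      · intro i
        fin_cases i <;> simp_all
  | succ h ih =>
    intro Q S hQ hS
    set M := {x ∈ Q | ∀ y ∈ Q, ¬ y < x} with hM
    have hMQ : M ⊆ Q := filter_subset _ _
    have hcard := card_sdiff_add_card_eq_card hMQ
    obtain ⟨t, ht⟩ := exists_card_filter_lt_eq S (r := #M + 1) (by omega)
    have hS' := card_filter_add_card_filter_not (s := S) (fun x => x < t)
    obtain ⟨φ, hinj, hmem, hle⟩ := ih (Q \ M) {x ∈ S | ¬ x < t} (by
      rintro ⟨c, hc, hcQ⟩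
      have h0 := hcQ 0
      simp only [hM, mem_sdiff, mem_filter, not_and, not_forall, not_not] at h0
      obtain ⟨x, hx, hx0⟩ := h0.2 h0.1
      refine hQ ⟨Fin.cons x c, ?_, ?_⟩
      · exact hc.vecCons hx0
      · intro i
        refine Fin.cases ?_ (fun j => ?_) i
        · simpa using hx
        · simpa using (mem_sdiff.1 (hcQ j)).1) (by omega)
    set e := 2 * ((t - 1) / 2)
    obtain ⟨f, hfinj, hfmem⟩ :=
      exists_injOn_of_card_le (M := M) (G := {x ∈ S | x < t}.erase e) (by
        have := pred_card_le_card_erase (s := {x ∈ S | x < t}) (a := e)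
        omega)
    simp only [mem_erase, mem_filter] at hfmem
    simp only [mem_filter, mem_sdiff] at hmem
    refine ⟨fun p => if p ∈ M then f p else φ p, ?_, ?_, ?_⟩
    · intro p hp q hq hpq
      rw [mem_coe] at hp hq
      by_cases hpM : p ∈ M <;> by_cases hqM : q ∈ M <;>
        simp only [hpM, hqM, if_true, if_false] at hpq
      · exact hfinj hpM hqM hpq
      · have := hfmem p hpM
        have := hmem q ⟨hq, hqM⟩
        omega
      · have := hfmem q hqM
        have := hmem p ⟨hp, hpM⟩
        omega
      · exact hinj (by simp [hp, hpM]) (by simp [hq, hqM]) hpq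
    · intro p hp
      by_cases hpM : p ∈ M
      · simpa [hpM] using (hfmem p hpM).2.1
      · simpa [hpM] using (hmem p ⟨hp, hpM⟩).1
    · intro p hp q hq hpq
      by_cases hqM : q ∈ M
      · obtain rfl : p = q := by
          by_contra hne
          exact (mem_filter.1 hqM).2 p hp (lt_of_le_of_ne hpq hne)
        exact .inl rfl
      · by_cases hpM : p ∈ M
        · have := hfmem p hpM
          have := hmem q ⟨hq, hqM⟩
          simp only [hpM, hqM, if_true, if_false, DoubleChainLE]
          omega
        · simpa [hpM, hqM] using
            hle p (mem_sdiff.2 ⟨hp, hpM⟩) q (mem_sdiff.2 ⟨hq, hqM⟩) hpq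

/-- The standard double chain in `2^[n]`: the odd index `2 * i + 1` gives the initial segment
of size `i`, and the even index `2 * i` gives that segment with its last element replaced
by the next one. -/
def doubleChain (n p : ℕ) : Finset (Fin n) :=
  {j | if p % 2 = 1 then j.1 < p / 2 else j.1 + 1 < p / 2 ∨ j.1 = p / 2}

theorem doubleChain_subset {n p q : ℕ} (hpq : DoubleChainLE p q) :
    doubleChain n p ⊆ doubleChain n q := by
  intro j
  unfold DoubleChainLE at hpq
  simp only [doubleChain, mem_filter, mem_univ, true_and]
  split_ifs <;> omega

/-- The indices of the nonempty members of the double chain. -/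
def doubleChainIndex (n : ℕ) : Finset ℕ :=
  insert (2 * n + 1) (Icc 2 (2 * n - 1))

theorem card_doubleChain_odd {n i : ℕ} (hi : i ≤ n) : #(doubleChain n (2 * i + 1)) = i := by
  have : doubleChain n (2 * i + 1) = ({j | j.1 < i} : Finset (Fin n)) := by
    ext j
    simp only [doubleChain, mem_filter, mem_univ, true_and]
    split_ifs <;> omega
  rw [this, Fin.card_filter_val_lt]
  omega

theorem card_doubleChain {n p : ℕ} (hp : p ∈ doubleChainIndex n) :
    #(doubleChain n p) = p / 2 := by
  simp only [doubleChainIndex, mem_insert, mem_Icc] at hp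
  rcases Nat.even_or_odd' p with ⟨i, rfl | rfl⟩
  · have hi : i < n := by omega
    have : doubleChain n (2 * i) =
        insert ⟨i, hi⟩ (doubleChain n (2 * (i - 1) + 1)) := by
      ext j
      simp only [doubleChain, mem_filter, mem_univ, true_and, mem_insert, Fin.ext_iff]
      split_ifs <;> omega
    rw [this, card_insert_of_notMem, card_doubleChain_odd (by omega)]
    · omega
    · simp only [doubleChain, mem_filter, mem_univ, true_and]
      split_ifs <;> omega
  · rw [card_doubleChain_odd (by omega)]
    omega

theorem doubleChain_injOn (n : ℕ) : Set.InjOn (doubleChain n) (doubleChainIndex n) := by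
  have key : ∀ i, 2 * i ∈ doubleChainIndex n →
      doubleChain n (2 * i) ≠ doubleChain n (2 * i + 1) := by
    intro i hi heq
    simp only [doubleChainIndex, mem_insert, mem_Icc] at hi
    have := congrArg (fun s => (⟨i, by omega⟩ : Fin n) ∈ s) heq
    simp only [doubleChain, mem_filter, mem_univ, true_and] at this
    split_ifs at this <;> first | omega | (simp at this; omega)
  intro p hp q hq hpq
  have hc := congrArg card hpq
  rw [card_doubleChain hp, card_doubleChain hq] at hc
  by_contra hne
  rcases Nat.lt_or_gt_of_ne hne with hlt | hlt
  · refine key (p / 2) ?_ ?_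
    · rwa [show 2 * (p / 2) = p by omega]
    · rwa [show 2 * (p / 2) = p by omega, show p + 1 = q by omega]
  · refine key (q / 2) ?_ ?_
    · rwa [show 2 * (q / 2) = q by omega]
    · rw [show 2 * (q / 2) = q by omega, show q + 1 = p by omega, hpq]

/-- The index of the complement of a member of the double chain, in the reversed double chain. -/
def doubleChainCompl (n p : ℕ) : ℕ :=
  if p % 2 = 1 then 2 * n + 2 - p else 2 * n - p

theorem doubleChain_map_rev {n p : ℕ} (hp : p ∈ Icc 2 (2 * n - 1)) :
    (doubleChain n p).map Fin.revPerm.toEmbedding = (doubleChain n (doubleChainCompl n p))ᶜ := by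
  rw [mem_Icc] at hp
  ext j
  have hj := j.2
  simp only [mem_map_equiv, mem_compl, doubleChain, mem_filter, mem_univ, true_and,
    doubleChainCompl, Fin.revPerm_symm, Fin.revPerm_apply, Fin.val_rev]
  split_ifs <;> simp only [mem_filter, mem_univ, true_and] <;> omega

/-- Permutations act transitively on finsets of a given size. -/
theorem exists_perm_map_eq {α : Type*} [Fintype α] [DecidableEq α] {A B : Finset α}
    (hAB : #A = #B) : ∃ τ : Equiv.Perm α, A.map τ.toEmbedding = B := by
  have e : {x // x ∈ A} ≃ {x // x ∈ B} := Finset.equivOfCardEq hAB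
  refine ⟨e.extendSubtype, eq_of_subset_of_card_le ?_ (by simp [hAB])⟩
  intro x hx
  obtain ⟨y, hy, rfl⟩ := mem_map.1 hx
  exact e.extendSubtype_mem y hy

/-- The proportion of permutations sending `A` into `F` is the density of `F` on the
level of `A`. -/
theorem choose_mul_card_filter_perm {n : ℕ} (F : Finset (Finset (Fin n))) (A : Finset (Fin n)) :
    n.choose #A * #{σ : Equiv.Perm (Fin n) | A.map σ.toEmbedding ∈ F} =
      n.factorial * #{B ∈ F | #B = #A} := by
  have hconst : ∀ B ∈ powersetCard #A (univ : Finset (Fin n)),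
      #{σ : Equiv.Perm (Fin n) | B.map σ.toEmbedding ∈ F} =
        #{σ : Equiv.Perm (Fin n) | A.map σ.toEmbedding ∈ F} := by
    intro B hB
    obtain ⟨τ, rfl⟩ := exists_perm_map_eq (mem_powersetCard.1 hB).2.symm
    refine card_bij (fun σ _ => τ.trans σ) ?_ ?_ ?_
    · intro σ hσ
      simpa [map_map] using hσ
    · intro σ _ σ' _ h
      ext x
      simpa using congrArg Fin.val (Equiv.congr_fun h (τ.symm x))
    · intro σ hσ
      refine ⟨τ.symm.trans σ, ?_, ?_⟩
      · simp only [mem_filter, mem_univ, true_and] at hσ ⊢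
        rw [map_map]
        convert hσ using 2
        ext x
        simp
      · ext x
        simp
  calc _ = ∑ B ∈ powersetCard #A (univ : Finset (Fin n)),
          #{σ : Equiv.Perm (Fin n) | B.map σ.toEmbedding ∈ F} := by
        rw [sum_congr rfl hconst]
        simp
    _ = ∑ σ : Equiv.Perm (Fin n),
          #{B ∈ powersetCard #A (univ : Finset (Fin n)) | B.map σ.toEmbedding ∈ F} :=
        sum_card_bipartiteAbove_eq_sum_card_bipartiteBelow _
    _ = ∑ σ : Equiv.Perm (Fin n), #{B ∈ F | #B = #A} := by
        refine sum_congr rfl fun σ _ => ?_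
        refine card_bij (fun B _ => B.map σ.toEmbedding) ?_ ?_ ?_
        · intro B hB
          simp only [mem_filter, mem_powersetCard, subset_univ, true_and] at hB
          simp [hB]
        · intro B _ B' _ h
          exact map_injective _ h
        · intro B hB
          rw [mem_filter] at hB
          refine ⟨B.map σ.symm.toEmbedding, ?_, ?_⟩
          · simp [map_map, hB]
          · simp [map_map]
    _ = _ := by simp [Fintype.card_perm]

/-- The weight making every nonempty member of `2^[n]` count twice over all double chains. -/
def doubleChainWeight (n p : ℕ) : ℕ :=
  if p = 2 * n + 1 then 2 else n.choose (p / 2)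

/-- The indices of the double chain twisted by `σ` whose sets lie in `F`. -/
def doubleChainTrace {n : ℕ} (F : Finset (Finset (Fin n))) (σ : Equiv.Perm (Fin n)) : Finset ℕ :=
  {p ∈ doubleChainIndex n | (doubleChain n p).map σ.toEmbedding ∈ F}

theorem sum_Icc_two_div (n : ℕ) (g : ℕ → ℕ) :
    ∑ p ∈ Icc 2 (2 * n - 1), g (p / 2) = 2 * ∑ i ∈ Ico 1 n, g i := by
  induction n with
  | zero => simp
  | succ n ih =>
    rcases n with _ | n
    · simp
    · rw [sum_Ico_succ_top (by omega), Nat.mul_add 2 (∑ i ∈ Ico 1 (n + 1), g i), ← ih,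
        show 2 * (n + 1 + 1) - 1 = (2 * (n + 1) - 1) + 1 + 1 by omega,
        sum_Icc_succ_top (by omega), sum_Icc_succ_top (by omega),
        show (2 * (n + 1) - 1 + 1) / 2 = n + 1 by omega,
        show (2 * (n + 1) - 1 + 1 + 1) / 2 = n + 1 by omega]
      ring

theorem sum_sum_weight_doubleChainTrace {n : ℕ} (F : Finset (Finset (Fin n))) (hF : ∅ ∉ F)
    (hn : 1 ≤ n) :
    ∑ σ : Equiv.Perm (Fin n), ∑ p ∈ doubleChainTrace F σ, doubleChainWeight n p =
      n.factorial * (2 * #F) := by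
  have hnot : 2 * n + 1 ∉ Icc 2 (2 * n - 1) := by
    rw [mem_Icc]
    omega
  have hlevel : ∀ p ∈ doubleChainIndex n,
      n.choose (p / 2) * #{σ : Equiv.Perm (Fin n) | (doubleChain n p).map σ.toEmbedding ∈ F} =
        n.factorial * #{B ∈ F | #B = p / 2} := by
    intro p hp
    simpa only [card_doubleChain hp] using choose_mul_card_filter_perm F (doubleChain n p)
  have hFcard : #F = ∑ i ∈ Ico 1 (n + 1), #{B ∈ F | #B = i} := by
    refine card_eq_sum_card_fiberwise fun B hB => ?_
    rw [coe_Ico, Set.mem_Ico]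
    refine ⟨?_, Nat.lt_succ_of_le (by simpa using card_le_univ B)⟩
    exact card_pos.2 (nonempty_iff_ne_empty.2 fun h => hF (h ▸ hB))
  calc _ = ∑ p ∈ doubleChainIndex n, doubleChainWeight n p *
          #{σ : Equiv.Perm (Fin n) | (doubleChain n p).map σ.toEmbedding ∈ F} := by
        simp only [doubleChainTrace, sum_filter]
        rw [sum_comm]
        refine sum_congr rfl fun p _ => ?_
        rw [← sum_filter, sum_const, smul_eq_mul, mul_comm]
    _ = n.factorial * (2 * #{B ∈ F | #B = n}) +
          ∑ p ∈ Icc 2 (2 * n - 1), n.factorial * #{B ∈ F | #B = p / 2} := by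
        rw [doubleChainIndex, sum_insert hnot]
        congr 1
        · have := hlevel (2 * n + 1) (mem_insert_self _ _)
          rw [show (2 * n + 1) / 2 = n by omega, Nat.choose_self, one_mul] at this
          rw [this, doubleChainWeight, if_pos rfl]
          ring
        · refine sum_congr rfl fun p hp => ?_
          rw [← hlevel p (mem_insert_of_mem hp), doubleChainWeight, if_neg]
          rintro rfl
          exact hnot hp
    _ = _ := by
        rw [← mul_sum, sum_Icc_two_div n fun i => #{B ∈ F | #B = i}, hFcard,
          sum_Ico_succ_top hn]
        ring

/-- Binomial coefficients decrease above the middle. -/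
theorem choose_add_antitone {n m : ℕ} (hn : n = 2 * m + 1) :
    Antitone fun i => n.choose (m + i) := by
  refine antitone_nat_of_succ_le fun i => ?_
  have h := Nat.choose_succ_right_eq n (m + i)
  refine Nat.le_of_mul_le_mul_right (c := m + i + 1) ?_ (by omega)
  exact h.trans_le (Nat.mul_le_mul_left _ (by omega))

/-- The total excess of the binomial coefficients of `2 * m + 1` over that of level `m + k` is
twice the excess coming from the upper half. -/
theorem sum_Ico_tsub_choose_eq {n m k : ℕ} (hn : n = 2 * m + 1) (hk : k ≤ m) :
    ∑ i ∈ Ico 1 n, (n.choose i - n.choose (m + k)) =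
      2 * ∑ i ∈ Icc 1 k, (n.choose (m + i) - n.choose (m + k)) := by
  set θ := n.choose (m + k)
  have hupper : ∑ i ∈ Ico (m + 1) n, (n.choose i - θ) =
      ∑ i ∈ Icc 1 k, (n.choose (m + i) - θ) := by
    symm
    refine sum_of_injOn (fun i => m + i) (fun a _ b _ => by simp) ?_ ?_ (fun _ _ => rfl)
    · intro i hi
      simp only [coe_Icc, Set.mem_Icc, coe_Ico, Set.mem_Ico] at hi ⊢
      omega
    · intro i hi hi'
      simp only [coe_Icc, Set.mem_image, Set.mem_Icc, mem_Ico, not_exists, not_and] at hi hi'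
      have hlt : m + k < i := by
        by_contra hle
        exact hi' (i - m) ⟨by omega, by omega⟩ (by omega)
      refine Nat.sub_eq_zero_of_le ?_
      rw [show i = m + (i - m) by omega]
      exact choose_add_antitone hn (by omega)
  have hlower : ∑ i ∈ Ico 1 (m + 1), (n.choose i - θ) =
      ∑ i ∈ Ico (m + 1) n, (n.choose i - θ) := by
    refine sum_nbij' (fun i => n - i) (fun i => n - i) ?_ ?_ ?_ ?_ ?_ <;>
      intro i hi <;> rw [mem_Ico] at hi
    · rw [mem_Ico]; omega
    · rw [mem_Ico]; omega
    · omega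
    · omega
    · rw [Nat.choose_symm (by omega)]
  rw [← sum_Ico_consecutive _ (show 1 ≤ m + 1 by omega) (show m + 1 ≤ n by omega),
    hlower, hupper]
  ring

/-- If `F` has no complementary pairs and meets each twisted double chain in at most `2 * k`
sets, its weight on a double chain and its reverse is at most that of the `k` lowest levels
above the middle. -/
theorem sum_weight_add_sum_weight_rev_le {n m k : ℕ} (hn : n = 2 * m + 1) (hm : 1 ≤ m)
    (hk : k ≤ m) (F : Finset (Finset (Fin n))) (hF : ∀ A ∈ F, Aᶜ ∉ F)
    (hcard : ∀ σ, #(doubleChainTrace F σ) ≤ 2 * k) (σ : Equiv.Perm (Fin n)) :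
    ∑ p ∈ doubleChainTrace F σ, doubleChainWeight n p +
      ∑ p ∈ doubleChainTrace F (Fin.revPerm.trans σ), doubleChainWeight n p ≤
      4 * ∑ i ∈ Icc 1 k, n.choose (m + i) := by
  set θ := n.choose (m + k) with hθ
  have hθ2 : 2 ≤ θ := by
    calc 2 ≤ n.choose (m + m) := by
          rw [← two_mul, hn, Nat.choose_succ_self_right]
          omega
      _ ≤ θ := choose_add_antitone hn hk
  set J := Icc 2 (2 * n - 1) with hJ
  let g : ℕ → ℕ := fun p => n.choose (p / 2) - θ
  have hbound : ∀ τ, ∑ p ∈ doubleChainTrace F τ, doubleChainWeight n p ≤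
      2 * k * θ + ∑ p ∈ doubleChainTrace F τ with p ∈ J, g p := by
    intro τ
    calc _ ≤ ∑ p ∈ doubleChainTrace F τ, (θ + if p ∈ J then g p else 0) := by
          refine sum_le_sum fun p hp => ?_
          rw [doubleChainTrace, mem_filter, doubleChainIndex, mem_insert] at hp
          by_cases hpn : p = 2 * n + 1
          · rw [doubleChainWeight, if_pos hpn]
            omega
          · rw [doubleChainWeight, if_neg hpn, if_pos (hp.1.resolve_left hpn)]
            exact le_add_tsub
      _ ≤ _ := by
          rw [sum_add_distrib, sum_const, smul_eq_mul, sum_filter]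
          gcongr
          exact hcard τ
  have hrev : ∑ p ∈ doubleChainTrace F (Fin.revPerm.trans σ) with p ∈ J, g p ≤
      ∑ p ∈ J \ doubleChainTrace F σ, g p := by
    have hinj : Set.InjOn (doubleChainCompl n)
        ({p ∈ doubleChainTrace F (Fin.revPerm.trans σ) | p ∈ J} : Finset ℕ) := by
      intro p hp q hq hpq
      simp only [coe_filter, Set.mem_ofPred_eq, hJ, mem_Icc] at hp hq
      unfold doubleChainCompl at hpq
      split_ifs at hpq <;> omega
    calc _ = ∑ p ∈ {p ∈ doubleChainTrace F (Fin.revPerm.trans σ) | p ∈ J}.image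
          (doubleChainCompl n), g p := by
          rw [sum_image hinj]
          refine sum_congr rfl fun p hp => ?_
          simp only [mem_filter, hJ, mem_Icc] at hp
          have : doubleChainCompl n p / 2 = n - p / 2 := by
            unfold doubleChainCompl
            split_ifs <;> omega
          simp only [g, this]
          rw [Nat.choose_symm (by omega)]
      _ ≤ _ := by
          refine sum_le_sum_of_subset fun q hq => ?_
          obtain ⟨p, hp, rfl⟩ := mem_image.1 hq
          rw [mem_filter] at hp
          refine mem_sdiff.2 ⟨?_, fun hmem => ?_⟩
          · have := hp.2
            simp only [hJ, mem_Icc, doubleChainCompl] at this ⊢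
            split_ifs <;> omega
          · have h1 := (mem_filter.1 hmem).2
            have h2 := (mem_filter.1 hp.1).2
            refine hF _ h1 ?_
            convert h2 using 1
            have := congrArg (Finset.map σ.toEmbedding) (doubleChain_map_rev hp.2)
            rw [map_map, ← Equiv.trans_toEmbedding] at this
            rw [this]
            ext x
            simp only [mem_compl, mem_map_equiv]
  have hsplit : ∑ p ∈ doubleChainTrace F σ with p ∈ J, g p + ∑ p ∈ J \ doubleChainTrace F σ, g p =
      ∑ p ∈ J, g p := by
    rw [filter_mem_eq_inter, inter_comm, sum_inter_add_sum_sdiff]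
  have htotal : ∑ p ∈ J, g p = 4 * ∑ i ∈ Icc 1 k, (n.choose (m + i) - θ) := by
    rw [hJ, sum_Icc_two_div n fun i => n.choose i - θ, sum_Ico_tsub_choose_eq hn hk]
    ring
  have hfinal : ∑ i ∈ Icc 1 k, (n.choose (m + i) - θ) + k * θ =
      ∑ i ∈ Icc 1 k, n.choose (m + i) := by
    have : k * θ = ∑ i ∈ Icc 1 k, θ := by simp
    rw [this, ← sum_add_distrib]
    refine sum_congr rfl fun i hi => Nat.sub_add_cancel ?_
    exact choose_add_antitone hn (mem_Icc.1 hi).2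
  have h1 := hbound σ
  have h2 := hbound (Fin.revPerm.trans σ)
  have h3 : 2 * k * θ = 2 * (k * θ) := by ring
  omega

/-- A family containing no copy of `P` meets every double chain in few sets. -/
theorem card_doubleChainTrace_lt {n h : ℕ} {P : Type*} [Fintype P] [PartialOrder P]
    (hnochain : ¬ ∃ c : Fin (h + 2) → P, StrictMono c) {F : Finset (Finset (Fin n))}
    (hPfree : ¬ ContainsPoset P F) (σ : Equiv.Perm (Fin n)) :
    #(doubleChainTrace F σ) < Fintype.card P + h := by
  by_contra hle
  obtain ⟨φ, hinj, hmem, hφ⟩ := exists_doubleChain_embedding h (univ : Finset P)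
    (doubleChainTrace F σ) (fun ⟨c, hc, _⟩ => hnochain ⟨c, hc⟩) (not_lt.1 hle)
  simp only [mem_univ, true_imp_iff] at hmem hφ
  refine hPfree ⟨fun p => (doubleChain n (φ p)).map σ.toEmbedding, ?_, ?_, ?_⟩
  · intro p q hpq
    exact hinj (by simp) (by simp) (doubleChain_injOn n (mem_filter.1 (hmem p)).1
      (mem_filter.1 (hmem q)).1 (map_injective _ hpq))
  · exact fun p => (mem_filter.1 (hmem p)).2
  · exact fun p q hpq => map_subset_map.2 (doubleChain_subset (hφ p q hpq))

theorem intersecting_Pfree_card_le (n : ℕ) (hn : 4 ≤ n) (hodd : n % 2 = 1)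
    (P : Type*) [Fintype P] [PartialOrder P] [Nonempty P]
    (h : ℕ)
    (hchain : ∃ c : Fin h → P, StrictMono c)
    (hnochain : ¬ ∃ c : Fin (h + 1) → P, StrictMono c)
    (heven : (Fintype.card P + h) % 2 = 0)
    (F : Finset (Finset (Fin n))) (hF : Intersecting F)
    (hPfree : ¬ ContainsPoset P F) :
    F.card ≤ ∑ i ∈ Finset.Icc 1 ((Fintype.card P + h) / 2 - 1),
      Nat.choose n (n / 2 + i) := by
  obtain ⟨m, rfl⟩ : ∃ m, n = 2 * m + 1 := ⟨n / 2, by omega⟩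
  obtain ⟨h, rfl⟩ : ∃ h', h = h' + 1 := by
    refine Nat.exists_eq_succ_of_ne_zero ?_
    rintro rfl
    exact hnochain ⟨fun _ => Classical.arbitrary P, fun i j hij => by omega⟩
  have hcompl : ∀ A ∈ F, Aᶜ ∉ F := by
    intro A hA hA'
    simpa using hF A hA _ hA'
  have hempty : ∅ ∉ F := fun h0 => by simpa using hF ∅ h0 ∅ h0
  rw [show (2 * m + 1) / 2 = m by omega]
  set k := (Fintype.card P + (h + 1)) / 2 - 1 with hk
  have hcard : ∀ σ, #(doubleChainTrace F σ) ≤ 2 * k := by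
    intro σ
    have := card_doubleChainTrace_lt hnochain hPfree σ
    omega
  rcases le_or_gt k m with hkm | hkm
  · have hsum := sum_sum_weight_doubleChainTrace F hempty (by omega)
    have hrev : ∑ σ : Equiv.Perm (Fin (2 * m + 1)),
        ∑ p ∈ doubleChainTrace F (Fin.revPerm.trans σ), doubleChainWeight (2 * m + 1) p =
        (2 * m + 1).factorial * (2 * #F) := by
      rw [← hsum]
      exact Fintype.sum_equiv (Equiv.mulRight Fin.revPerm) _ _ fun σ => rfl
    have hle := sum_le_sum fun σ (_ : σ ∈ (univ : Finset (Equiv.Perm (Fin (2 * m + 1))))) =>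
      sum_weight_add_sum_weight_rev_le rfl (by omega) hkm F hcompl hcard σ
    rw [sum_add_distrib, hsum, hrev, sum_const, card_univ, Fintype.card_perm, Fintype.card_fin,
      smul_eq_mul, ← mul_add] at hle
    have := Nat.le_of_mul_le_mul_left hle (Nat.factorial_pos _)
    omega
  · have hint : (F : Set (Finset (Fin (2 * m + 1)))).Intersecting := by
      intro A hA B hB hAB
      exact (hF A hA B hB).ne_empty (disjoint_iff_inter_eq_empty.1 hAB)
    have h2 := hint.card_le
    rw [Fintype.card_finset, Fintype.card_fin, pow_succ, pow_mul] at h2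
    have hhalf : ∑ i ∈ Icc 1 (m + 1), (2 * m + 1).choose (m + i) = 4 ^ m := by
      rw [← Nat.sum_range_choose_halfway m]
      refine sum_nbij' (fun i => m + 1 - i) (fun i => m + 1 - i) ?_ ?_ ?_ ?_ ?_ <;> intro i hi
      · rw [mem_Icc] at hi; rw [mem_range]; omega
      · rw [mem_range] at hi; rw [mem_Icc]; omega
      · rw [mem_Icc] at hi; omega
      · rw [mem_range] at hi; omega
      · rw [mem_Icc] at hi
        rw [← Nat.choose_symm (by omega)]
        congr 1
        omega
    have hmono : ∑ i ∈ Icc 1 (m + 1), (2 * m + 1).choose (m + i) ≤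
        ∑ i ∈ Icc 1 k, (2 * m + 1).choose (m + i) :=
      sum_le_sum_of_subset (Icc_subset_Icc_right (by omega))
    norm_num at h2
    omega
end
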